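/- Let (W,S) be a Coxeter system such that (W,S) is irreducible, nonspherical (W infinite) and nonaffine. Then any Coxeter element of W (a product of all elements of S in some order) is a rank one element: it acts as a hyperbolic isometry on the Davis complex and its axes are rank one geodesics (do not bound a flat half-plane). -/

import Mathlib

/-!
STATEMENT 7: Let `(W,S)` be irreducible, infinite and nonaffine. Then any Coxeter
element of `W` is a rank one element for the action of `W` on its Davis complex:
it is a hyperbolic isometry, and none of its axes bounds a flat half-plane.

The Davis complex is formalized as a proper geodesic `CAT(0)` space (via the
`CN` midpoint inequality) on which `W` acts properly discontinuously and
cocompactly by isometries.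
-/

variable {B W : Type*} [Group W] {M : CoxeterMatrix B}

def CoxeterSystem.SetsCommute (cs : CoxeterSystem M W) (A K : Set B) : Prop :=
  ∀ a ∈ A, ∀ k ∈ K, Commute (cs.simple a) (cs.simple k)

/-- `(W,S)` is irreducible: `S` admits no nontrivial partition into two disjoint
commuting subsets. -/
def CoxeterSystem.IsIrreducibleSystem (cs : CoxeterSystem M W) : Prop :=
  ∀ A K : Set B, A ∪ K = Set.univ → Disjoint A K → cs.SetsCommute A K →
    A = ∅ ∨ K = ∅

/-- A geodesic metric space: any two points are joined by an isometrically
parametrised path. -/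
def IsGeodesicSpace (X : Type*) [MetricSpace X] : Prop :=
  ∀ x y : X, ∃ γ : ℝ → X, γ 0 = x ∧ γ (dist x y) = y ∧
    ∀ s ∈ Set.Icc (0 : ℝ) (dist x y), ∀ t ∈ Set.Icc (0 : ℝ) (dist x y),
      dist (γ s) (γ t) = |s - t|

/-- The CN (Bruhat–Tits) inequality, characterising `CAT(0)` among geodesic
spaces: for every midpoint `m` of `y` and `z`,
`d(x,m)² ≤ (d(x,y)² + d(x,z)²)/2 − d(y,z)²/4`. -/
def SatisfiesCN (X : Type*) [MetricSpace X] : Prop :=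
  ∀ x y z m : X, dist y m = dist y z / 2 → dist m z = dist y z / 2 →
    dist x m ^ 2 ≤ (dist x y ^ 2 + dist x z ^ 2) / 2 - dist y z ^ 2 / 4

/-- `γ` is a (complete) geodesic line. -/
def IsGeodesicLine {X : Type*} [MetricSpace X] (γ : ℝ → X) : Prop :=
  ∀ s t : ℝ, dist (γ s) (γ t) = |s - t|

/-- `γ` is an axis for the isometry given by `w`, with translation length `L`. -/
def IsAxisOf {X : Type*} [MetricSpace X] [MulAction W X] (w : W) (γ : ℝ → X)
    (L : ℝ) : Prop :=
  IsGeodesicLine γ ∧ 0 < L ∧ ∀ t : ℝ, w • γ t = γ (t + L)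

/-- The geodesic line `γ` bounds a flat (Euclidean) half-plane. -/
def BoundsFlatHalfPlane {X : Type*} [MetricSpace X] (γ : ℝ → X) : Prop :=
  ∃ φ : ℝ × ℝ → X,
    (∀ p q : ℝ × ℝ, 0 ≤ p.2 → 0 ≤ q.2 →
      dist (φ p) (φ q) = Real.sqrt ((p.1 - q.1) ^ 2 + (p.2 - q.2) ^ 2)) ∧
    ∀ t : ℝ, φ (t, 0) = γ t

set_option linter.unusedSectionVars false

namespace CoxRank

section Rep

variable [Fintype B] [DecidableEq B]

/-- Twice the entries of the standard bilinear form: `-2 cos (π / m i j)`. -/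
noncomputable def entry (M : CoxeterMatrix B) (i j : B) : ℝ :=
  -2 * Real.cos (Real.pi / M i j)

/-- The standard bilinear form, normalised so that roots have square two. -/
noncomputable def form (M : CoxeterMatrix B) : (B → ℝ) →ₗ[ℝ] (B → ℝ) →ₗ[ℝ] ℝ :=
  Matrix.toLinearMap₂' ℝ (Matrix.of (entry M))

/-- The simple root attached to a generator. -/
def α (i : B) : B → ℝ := Pi.single i 1


theorem entry_self (i : B) : entry M i i = 2 := by
  simp [entry]

theorem entry_comm (i j : B) : entry M i j = entry M j i := by
  simp [entry, M.symmetric i j]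

theorem entry_eq_of_two_le {i j : B} (h : i ≠ j) :
    M i j = 0 ∨ 2 ≤ M i j := by
  have := M.off_diagonal i j h
  omega

theorem entry_nonpos {i j : B} (h : i ≠ j) : entry M i j ≤ 0 := by
  have : 0 ≤ Real.cos (Real.pi / M i j) := by
    rcases entry_eq_of_two_le (M := M) h with h0 | h2
    · simp [h0]
    · have h2' : (2 : ℝ) ≤ M i j := by exact_mod_cast h2
      apply Real.cos_nonneg_of_neg_pi_div_two_le_of_le
      · have := Real.pi_pos
        have : 0 ≤ Real.pi / M i j := by positivity
        linarith
      · exact div_le_div_of_nonneg_left Real.pi_pos.le (by norm_num) h2'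
  unfold entry; linarith

theorem eq_two_of_entry_eq_zero {i j : B} (h : entry M i j = 0) : M i j = 2 := by
  have hij : i ≠ j := by
    rintro rfl
    rw [entry_self] at h; norm_num at h
  have hc : Real.cos (Real.pi / M i j) = 0 := by
    unfold entry at h; linarith
  rcases entry_eq_of_two_le (M := M) hij with h0 | h2
  · simp [h0] at hc
  · by_contra hne
    have h3 : (2 : ℝ) < M i j := by
      have : 2 < M i j := by omega
      exact_mod_cast this
    have : 0 < Real.cos (Real.pi / M i j) := by
      apply Real.cos_pos_of_mem_Ioo
      have := Real.pi_pos
      refine ⟨?_, ?_⟩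
      · have : 0 ≤ Real.pi / M i j := by positivity
        linarith
      · exact div_lt_div_of_pos_left Real.pi_pos (by norm_num) h3
    linarith

theorem form_apply (x y : B → ℝ) :
    form M x y = ∑ i, ∑ j, entry M i j * x i * y j := by
  simp only [form, Matrix.toLinearMap₂'_apply, Matrix.of_apply, smul_eq_mul]
  exact Finset.sum_congr rfl fun i _ => Finset.sum_congr rfl fun j _ => by ring

theorem form_comm (x y : B → ℝ) : form M x y = form M y x := by
  rw [form_apply, form_apply, Finset.sum_comm]
  refine Finset.sum_congr rfl fun i _ => Finset.sum_congr rfl fun j _ => ?_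
  rw [entry_comm]; ring

theorem form_α_left (i : B) (x : B → ℝ) : form M (α i) x = ∑ j, entry M i j * x j := by
  rw [form_apply, Finset.sum_eq_single i]
  · simp [α]
  · intro b _ hb; simp [α, hb]
  · simp

theorem form_α_α (i j : B) : form M (α i) (α j) = entry M i j := by
  rw [form_α_left, Finset.sum_eq_single j]
  · simp [α]
  · intro b _ hb; simp [α, hb]
  · simp

/-- The reflection in the vector `x` (of square two). -/
noncomputable def reflVec (M : CoxeterMatrix B) (x : B → ℝ) : (B → ℝ) →ₗ[ℝ] (B → ℝ) :=
  LinearMap.id - (form M x).smulRight x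

theorem reflVec_apply (x y : B → ℝ) : reflVec M x y = y - form M x y • x := by
  simp [reflVec]

/-- Normalised Chebyshev sequence. -/
def cheb (t : ℝ) : ℕ → ℝ
  | 0 => 0
  | 1 => 1
  | k + 2 => t * cheb t (k + 1) - cheb t k

theorem cheb_sin (θ : ℝ) (k : ℕ) :
    cheb (2 * Real.cos θ) k * Real.sin θ = Real.sin (k * θ) := by
  induction k using Nat.twoStepInduction with
  | zero => simp [cheb]
  | one => simp [cheb]
  | more k h1 h2 =>
    have e1 : Real.sin ((k + 2 : ℕ) * θ) =
        2 * Real.cos θ * Real.sin ((k + 1 : ℕ) * θ) - Real.sin (k * θ) := by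
      have a1 : ((k + 2 : ℕ) : ℝ) * θ = (k + 1 : ℕ) * θ + θ := by push_cast; ring
      have a2 : (k : ℝ) * θ = (k + 1 : ℕ) * θ - θ := by push_cast; ring
      rw [a1, a2, Real.sin_add, Real.sin_sub]; ring
    rw [e1, ← h1, ← h2, cheb]; ring

theorem cheb_two (k : ℕ) : cheb 2 k = k := by
  induction k using Nat.twoStepInduction with
  | zero => simp [cheb]
  | one => simp [cheb]
  | more k h1 h2 => rw [cheb, h1, h2]; push_cast; ring

theorem sin_pi_div_pos {m : ℕ} (hm : 2 ≤ m) : 0 < Real.sin (Real.pi / m) := by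
  have h2 : (2 : ℝ) ≤ m := by exact_mod_cast hm
  apply Real.sin_pos_of_pos_of_lt_pi
  · have := Real.pi_pos; positivity
  · rw [div_lt_iff₀ (by linarith)]
    nlinarith [Real.pi_pos]

theorem neg_entry (i j : B) : -entry M i j = 2 * Real.cos (Real.pi / M i j) := by
  unfold entry; ring

theorem cheb_nonneg {i j : B} (h : i ≠ j) {k : ℕ} (hk : M i j = 0 ∨ k ≤ M i j) :
    0 ≤ cheb (-entry M i j) k := by
  rcases entry_eq_of_two_le (M := M) h with h0 | h2
  · have : -entry M i j = 2 := by simp [entry, h0]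
    rw [this, cheb_two]; positivity
  · have hk : k ≤ M i j := by omega
    have hs := sin_pi_div_pos h2
    have h1 := cheb_sin (Real.pi / M i j) k
    rw [neg_entry]
    have : 0 ≤ Real.sin (k * (Real.pi / M i j)) := by
      have hm : (0 : ℝ) < M i j := by exact_mod_cast (by omega : 0 < M i j)
      apply Real.sin_nonneg_of_nonneg_of_le_pi
      · have := Real.pi_pos; positivity
      · have hk' : (k : ℝ) ≤ M i j := by exact_mod_cast hk
        rw [← mul_div_assoc, div_le_iff₀ hm]
        nlinarith [Real.pi_pos]
    rw [← h1] at this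
    exact nonneg_of_mul_nonneg_left this hs

theorem reflVec_α_self (i : B) : reflVec M (α i) (α i) = -α i := by
  rw [reflVec_apply, form_α_α, entry_self, two_smul]; abel

theorem reflVec_α_α (i j : B) : reflVec M (α i) (α j) = α j + (-entry M i j) • α i := by
  rw [reflVec_apply, form_α_α, neg_smul]; abel

theorem reflVec_mul_pow_apply_left (i j : B) (k : ℕ) :
    ((reflVec M (α i) * reflVec M (α j)) ^ k) (α i) =
      cheb (-entry M i j) (2 * k + 1) • α i + cheb (-entry M i j) (2 * k) • α j := by
  induction k with
  | zero => simp [cheb]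
  | succ k ih =>
    rw [pow_succ', Module.End.mul_apply, ih, Module.End.mul_apply]
    simp only [map_add, map_smul, reflVec_α_self, reflVec_α_α, map_neg, entry_comm j i]
    have e1 : cheb (-entry M i j) (2 * (k + 1)) =
      -entry M i j * cheb (-entry M i j) (2 * k + 1) - cheb (-entry M i j) (2 * k) := rfl
    have e2 : cheb (-entry M i j) (2 * (k + 1) + 1) =
      -entry M i j * cheb (-entry M i j) (2 * (k + 1)) - cheb (-entry M i j) (2 * k + 1) := rfl
    rw [e2, e1]
    module

theorem reflVec_mul_pow_apply_right (i j : B) (k : ℕ) :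
    ((reflVec M (α i) * reflVec M (α j)) ^ (k + 1)) (α j) =
      -(cheb (-entry M i j) (2 * k + 2) • α i + cheb (-entry M i j) (2 * k + 1) • α j) := by
  rw [pow_succ, Module.End.mul_apply, Module.End.mul_apply, reflVec_α_self, map_neg,
    reflVec_α_α, map_neg, map_add, map_smul, reflVec_mul_pow_apply_left]
  have h2 : ((reflVec M (α i) * reflVec M (α j)) ^ k) (α j) =
      - (cheb (-entry M i j) (2 * k) • α i +
        (-entry M i j * cheb (-entry M i j) (2 * k) - cheb (-entry M i j) (2 * k + 1)) • α j) := by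
    induction k with
    | zero => simp [cheb]
    | succ k ih =>
      rw [pow_succ', Module.End.mul_apply, ih,
        Module.End.mul_apply]
      simp only [map_add, map_smul, reflVec_α_self, reflVec_α_α, map_neg, entry_comm j i]
      have e1 : cheb (-entry M i j) (2 * (k + 1)) =
        -entry M i j * cheb (-entry M i j) (2 * k + 1) - cheb (-entry M i j) (2 * k) := rfl
      have e2 : cheb (-entry M i j) (2 * (k + 1) + 1) =
        -entry M i j * cheb (-entry M i j) (2 * (k + 1)) - cheb (-entry M i j) (2 * k + 1) := rfl
      rw [e2, e1]
      module
  rw [h2]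
  have e1 : cheb (-entry M i j) (2 * k + 2) =
      -entry M i j * cheb (-entry M i j) (2 * k + 1) - cheb (-entry M i j) (2 * k) := rfl
  rw [e1]
  module

theorem isLiftable_reflVec : M.IsLiftable (fun i => reflVec M (α i)) := by
  intro i j
  rcases eq_or_ne i j with rfl | hij
  · rw [M.diagonal, pow_one]
    ext1 b
    ext1
    simp only [LinearMap.comp_apply, Module.End.mul_apply, reflVec_apply, map_sub, map_smul,
      form_α_α, entry_self, Module.End.one_apply]
    module
  rcases entry_eq_of_two_le (M := M) hij with h0 | h2
  · rw [h0, pow_zero]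
  set m := M i j with hm
  set θ := Real.pi / m with hθ
  have hs : 0 < Real.sin θ := sin_pi_div_pos h2
  have ht : -entry M i j = 2 * Real.cos θ := neg_entry i j
  have hmθ : (m : ℝ) * θ = Real.pi := by
    have : (m : ℝ) ≠ 0 := by exact_mod_cast (by omega : m ≠ 0)
    rw [hθ]; field_simp
  have c1 : cheb (2 * Real.cos θ) (2 * m + 1) = 1 := by
    have := cheb_sin θ (2 * m + 1)
    rw [show ((2 * m + 1 : ℕ) : ℝ) * θ = θ + 2 * Real.pi by push_cast; rw [← hmθ]; ring,
      Real.sin_add_two_pi] at this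
    exact mul_right_cancel₀ hs.ne' (by linarith)
  have c0 : cheb (2 * Real.cos θ) (2 * m) = 0 := by
    have := cheb_sin θ (2 * m)
    rw [show ((2 * m : ℕ) : ℝ) * θ = 2 * Real.pi by push_cast; rw [← hmθ]; ring,
      Real.sin_two_pi] at this
    exact (mul_eq_zero.mp this).resolve_right hs.ne'
  have cm : cheb (2 * Real.cos θ) (2 * m - 1) = -1 := by
    have := cheb_sin θ (2 * m - 1)
    rw [show ((2 * m - 1 : ℕ) : ℝ) * θ = -θ + 2 * Real.pi by
      rw [Nat.cast_sub (by omega)]; push_cast; rw [← hmθ]; ring,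
      Real.sin_add_two_pi, Real.sin_neg] at this
    exact mul_right_cancel₀ hs.ne' (by linarith)
  set R := reflVec M (α i) * reflVec M (α j) with hR
  have Ri : (R ^ m) (α i) = α i := by
    rw [hR, reflVec_mul_pow_apply_left, ht, c1, c0]; simp
  have Rj : (R ^ m) (α j) = α j := by
    obtain ⟨k, hk⟩ : ∃ k, m = k + 1 := ⟨m - 1, by omega⟩
    rw [hR, hk, reflVec_mul_pow_apply_right, ht]
    rw [show 2 * k + 2 = 2 * m by omega, show 2 * k + 1 = 2 * m - 1 by omega, c0, cm]; simp
  have Rz : ∀ z, form M (α i) z = 0 → form M (α j) z = 0 → ∀ k : ℕ, (R ^ k) z = z := by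
    intro z h1 h2 k
    induction k with
    | zero => simp
    | succ k ih =>
      rw [pow_succ', Module.End.mul_apply, ih, hR, Module.End.mul_apply, reflVec_apply (α j), h2,
        zero_smul, sub_zero, reflVec_apply, h1, zero_smul, sub_zero]
  refine LinearMap.ext fun x => ?_
  have hE : entry M i j = -(2 * Real.cos θ) := by linarith
  set p := form M (α i) x with hp
  set q := form M (α j) x with hq
  set u := (p + Real.cos θ * q) / (2 * Real.sin θ ^ 2) with hu
  set v := (q + Real.cos θ * p) / (2 * Real.sin θ ^ 2) with hv
  have hsc : Real.sin θ ^ 2 = 1 - Real.cos θ ^ 2 := Real.sin_sq θ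
  have hpuv : p = 2 * u - 2 * Real.cos θ * v := by
    rw [hu, hv]
    field_simp
    rw [hsc]; ring
  have hquv : q = 2 * v - 2 * Real.cos θ * u := by
    rw [hu, hv]
    field_simp
    rw [hsc]; ring
  have hz := Rz (x - u • α i - v • α j)
    (by
      simp only [map_sub, map_smul, form_α_α, entry_self, smul_eq_mul, hE]
      linarith)
    (by
      simp only [map_sub, map_smul, form_α_α, entry_self, smul_eq_mul, entry_comm j i, hE]
      linarith) m
  simp only [map_sub, map_smul, Ri, Rj] at hz
  have := congrArg (fun y => y + u • α i + v • α j) hz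
  simpa using this

/-- The geometric representation. -/
noncomputable def rep (cs : CoxeterSystem M W) : W →* ((B → ℝ) →ₗ[ℝ] (B → ℝ)) :=
  cs.lift ⟨fun i => reflVec M (α i), isLiftable_reflVec⟩

variable (cs : CoxeterSystem M W)

theorem rep_simple (i : B) : rep cs (cs.simple i) = reflVec M (α i) :=
  cs.lift_apply_simple isLiftable_reflVec i

theorem rep_mul_apply (g h : W) (x : B → ℝ) : rep cs (g * h) x = rep cs g (rep cs h x) := by
  rw [map_mul]; rfl

@[simp] theorem rep_one_apply (x : B → ℝ) : rep cs 1 x = x := by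
  rw [map_one]; rfl

@[simp] theorem rep_inv_rep (g : W) (x : B → ℝ) : rep cs g⁻¹ (rep cs g x) = x := by
  rw [← rep_mul_apply, inv_mul_cancel, rep_one_apply]

@[simp] theorem rep_rep_inv (g : W) (x : B → ℝ) : rep cs g (rep cs g⁻¹ x) = x := by
  rw [← rep_mul_apply, mul_inv_cancel, rep_one_apply]

theorem rep_injective (g : W) : Function.Injective (rep cs g) := fun x y h => by
  rw [← rep_inv_rep cs g x, h, rep_inv_rep]

theorem rep_simple_apply (i : B) (x : B → ℝ) :
    rep cs (cs.simple i) x = x - form M (α i) x • α i := by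
  rw [rep_simple, reflVec_apply]

theorem rep_simple_α (i : B) : rep cs (cs.simple i) (α i) = -α i := by
  rw [rep_simple, reflVec_α_self]

theorem form_rep_rep (g : W) (x y : B → ℝ) : form M (rep cs g x) (rep cs g y) = form M x y := by
  induction g using cs.simple_induction_left generalizing x y with
  | one => simp
  | mul_simple_left g i ih =>
    rw [rep_mul_apply, rep_mul_apply, rep_simple_apply, rep_simple_apply]
    simp only [map_sub, map_smul, LinearMap.sub_apply, LinearMap.smul_apply, smul_eq_mul,
      form_α_α, entry_self, ih]
    rw [form_comm _ (α i)]
    ring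

theorem form_rep_left (g : W) (x y : B → ℝ) : form M (rep cs g x) y = form M x (rep cs g⁻¹ y) := by
  rw [← form_rep_rep cs g⁻¹, rep_inv_rep]

end Rep

section Roots

variable [Fintype B] [DecidableEq B] (cs : CoxeterSystem M W)

open CoxeterSystem

theorem α_nonneg (i : B) : (0 : B → ℝ) ≤ α i := by
  intro b
  by_cases h : b = i
  · subst h; simp [α]
  · simp [α, h]

theorem rep_alternatingWord_α (i j : B) (k : ℕ) :
    rep cs (cs.wordProd (alternatingWord i j k)) (α i) =
      if Even k then cheb (-entry M i j) (k + 1) • α i + cheb (-entry M i j) k • α j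
      else cheb (-entry M i j) k • α i + cheb (-entry M i j) (k + 1) • α j := by
  induction k with
  | zero => simp [alternatingWord, cheb]
  | succ k ih =>
    rw [alternatingWord_succ', wordProd_cons, rep_mul_apply, ih]
    have e : cheb (-entry M i j) (k + 1 + 1) =
      -entry M i j * cheb (-entry M i j) (k + 1) - cheb (-entry M i j) k := rfl
    by_cases h : Even k
    · simp only [h, if_true, Nat.even_add_one, not_true_eq_false, if_false, map_add, map_smul,
        rep_simple, reflVec_α_self, reflVec_α_α, entry_comm j i, e]
      module
    · simp only [h, if_false, Nat.even_add_one, not_false_eq_true, if_true, map_add, map_smul,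
        rep_simple, reflVec_α_self, reflVec_α_α, e]
      module

theorem length_mul_alternatingWord_le (v : W) (i j : B) (k : ℕ) :
    cs.length (v * cs.wordProd (alternatingWord i j k)) ≤ cs.length v + k := by
  refine (cs.length_mul_le _ _).trans ?_
  have := cs.length_wordProd_le (alternatingWord i j k)
  rw [length_alternatingWord] at this
  omega

/-- A length-increasing generator corresponds to a positive root. -/
theorem rep_α_nonneg (g : W) (i : B) (h : cs.length g < cs.length (g * cs.simple i)) :
    0 ≤ rep cs g (α i) := by
  induction hn : cs.length g using Nat.strong_induction_on generalizing g i with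
  | _ n ih =>
  subst hn
  by_cases hg : g = 1
  · subst hg; simpa using α_nonneg i
  obtain ⟨j, hj⟩ := cs.exists_rightDescent_of_ne_one hg
  have hj' : cs.length (g * cs.simple j) < cs.length g := hj
  have hij : i ≠ j := by
    rintro rfl; omega
  let P : ℕ → Prop := fun k =>
    ∃ v, g = v * cs.wordProd (alternatingWord i j k) ∧ cs.length v + k = cs.length g
  have P0 : P 0 := ⟨g, by simp [alternatingWord]⟩
  have P1 : P 1 := by
    refine ⟨g * cs.simple j, by simp [alternatingWord], ?_⟩
    rcases cs.length_mul_simple g j with h1 | h1 <;> omega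
  have Pfail : ∃ k, ¬ P k := by
    refine ⟨cs.length g + 1, ?_⟩
    rintro ⟨v, -, hv⟩; omega
  classical
  obtain ⟨k, hk⟩ : ∃ k, Nat.find Pfail = k + 2 := by
    have h0 : Nat.find Pfail ≠ 0 := fun h0 => Nat.find_spec Pfail (by rw [h0]; exact P0)
    have h1 : Nat.find Pfail ≠ 1 := fun h1 => Nat.find_spec Pfail (by rw [h1]; exact P1)
    exact ⟨Nat.find Pfail - 2, by omega⟩
  have hnot : ¬ P (k + 2) := hk ▸ Nat.find_spec Pfail
  have hyes : ∀ m, m ≤ k + 1 → P m := fun m hm => by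
    have := Nat.find_min Pfail (m := m) (by omega)
    exact not_not.mp this
  obtain ⟨v, hv, hlv⟩ := hyes (k + 1) le_rfl
  have hnext : cs.length v < cs.length (v * cs.simple (if Even (k + 1) then j else i)) := by
    by_contra hlt
    set y := if Even (k + 1) then j else i with hy
    refine hnot ⟨v * cs.simple y, ?_, ?_⟩
    · rw [alternatingWord_succ', wordProd_cons, ← hy, ← mul_assoc, mul_assoc v,
        cs.simple_mul_simple_self, mul_one, hv]
    · rcases cs.length_mul_simple v y with h1 | h1 <;> omega
  have hprev : cs.length v < cs.length (v * cs.simple (if Even k then j else i)) := by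
    by_contra hlt
    set y := if Even k then j else i with hy
    have e : g = v * cs.simple y * cs.wordProd (alternatingWord i j k) := by
      rw [hv, alternatingWord_succ', wordProd_cons, ← hy, ← mul_assoc]
    have := length_mul_alternatingWord_le cs (v * cs.simple y) i j k
    rw [← e] at this
    rcases cs.length_mul_simple v y with h1 | h1 <;> omega
  have hvij : 0 ≤ rep cs v (α i) ∧ 0 ≤ rep cs v (α j) := by
    have hlt : cs.length v < cs.length g := by omega
    by_cases hev : Even k
    · simp only [hev, if_true, Nat.even_add_one, not_true_eq_false, if_false] at hnext hprev
      exact ⟨ih _ hlt v i hnext rfl, ih _ hlt v j hprev rfl⟩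
    · simp only [hev, if_false, Nat.even_add_one, not_false_eq_true, if_true] at hnext hprev
      exact ⟨ih _ hlt v i hprev rfl, ih _ hlt v j hnext rfl⟩
  have hm : M i j = 0 ∨ k + 2 ≤ M i j := by
    by_contra hcon
    push Not at hcon
    obtain ⟨hm0, hmk⟩ := hcon
    obtain ⟨u, hu, hlu⟩ := hyes (M i j) (by omega)
    obtain ⟨m, hm⟩ : ∃ m, M i j = m + 1 := ⟨M i j - 1, by omega⟩
    have hb := cs.wordProd_braidWord_eq i j
    have e : g * cs.simple i = u * cs.wordProd (alternatingWord i j m) := by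
      rw [hu]
      have : cs.wordProd (alternatingWord i j (M i j)) =
          cs.wordProd (alternatingWord i j m) * cs.simple i := by
        rw [hb, braidWord, M.symmetric j i, hm, alternatingWord_succ, wordProd_concat]
      rw [this, ← mul_assoc, mul_assoc, cs.simple_mul_simple_self, mul_one]
    have := length_mul_alternatingWord_le cs u i j m
    rw [← e] at this
    omega
  have c1 : 0 ≤ cheb (-entry M i j) (k + 1) := cheb_nonneg hij (by omega)
  have c2 : 0 ≤ cheb (-entry M i j) (k + 1 + 1) := cheb_nonneg hij (by omega)
  rw [hv, rep_mul_apply, rep_alternatingWord_α]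
  split_ifs <;> rw [map_add, map_smul, map_smul] <;>
    exact add_nonneg (smul_nonneg (by assumption) hvij.1) (smul_nonneg (by assumption) hvij.2)

theorem rep_α_nonneg_or_nonpos (g : W) (i : B) :
    (cs.length g < cs.length (g * cs.simple i) ∧ 0 ≤ rep cs g (α i)) ∨
      (cs.length (g * cs.simple i) < cs.length g ∧ rep cs g (α i) ≤ 0) := by
  rcases cs.length_mul_simple g i with h | h
  · left; exact ⟨by omega, rep_α_nonneg cs g i (by omega)⟩
  · right
    refine ⟨by omega, ?_⟩
    have := rep_α_nonneg cs (g * cs.simple i) i (by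
      rw [mul_assoc, cs.simple_mul_simple_self, mul_one]; omega)
    rw [rep_mul_apply, rep_simple_α, map_neg] at this
    simpa using this

/-- The root system. -/
def IsRoot (x : B → ℝ) : Prop := ∃ g i, x = rep cs g (α i)

variable {cs}

theorem isRoot_α (i : B) : IsRoot cs (α i) := ⟨1, i, by simp⟩

theorem IsRoot.rep {x : B → ℝ} (hx : IsRoot cs x) (g : W) : IsRoot cs (rep cs g x) := by
  obtain ⟨h, i, rfl⟩ := hx
  exact ⟨g * h, i, (rep_mul_apply cs g h _).symm⟩

theorem IsRoot.neg {x : B → ℝ} (hx : IsRoot cs x) : IsRoot cs (-x) := by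
  obtain ⟨h, i, rfl⟩ := hx
  exact ⟨h * cs.simple i, i, by rw [rep_mul_apply, rep_simple_α, map_neg]⟩

theorem IsRoot.form_self {x : B → ℝ} (hx : IsRoot cs x) : form M x x = 2 := by
  obtain ⟨h, i, rfl⟩ := hx
  rw [form_rep_rep, form_α_α, entry_self]

theorem IsRoot.ne_zero {x : B → ℝ} (hx : IsRoot cs x) : x ≠ 0 := by
  rintro rfl
  have := hx.form_self
  simp at this

theorem IsRoot.nonneg_or_nonpos {x : B → ℝ} (hx : IsRoot cs x) : 0 ≤ x ∨ x ≤ 0 := by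
  obtain ⟨h, i, rfl⟩ := hx
  rcases rep_α_nonneg_or_nonpos cs h i with h | h
  · exact Or.inl h.2
  · exact Or.inr h.2

theorem IsRoot.not_nonpos {x : B → ℝ} (hx : IsRoot cs x) (h : 0 ≤ x) : ¬ x ≤ 0 :=
  fun h' => hx.ne_zero (le_antisymm h' h)

theorem IsRoot.not_nonneg_iff {x : B → ℝ} (hx : IsRoot cs x) : ¬ 0 ≤ x ↔ x ≤ 0 :=
  ⟨fun h => hx.nonneg_or_nonpos.resolve_left h, fun h h' => hx.not_nonpos h' h⟩

theorem IsRoot.not_nonpos_iff {x : B → ℝ} (hx : IsRoot cs x) : ¬ x ≤ 0 ↔ 0 ≤ x :=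
  ⟨fun h => hx.nonneg_or_nonpos.resolve_right h, fun h => hx.not_nonpos h⟩

theorem IsRoot.exists_reflection {x : B → ℝ} (hx : IsRoot cs x) :
    ∃ r : W, ∀ y, CoxRank.rep cs r y = y - form M x y • x := by
  obtain ⟨h, i, rfl⟩ := hx
  refine ⟨h * cs.simple i * h⁻¹, fun y => ?_⟩
  rw [rep_mul_apply, rep_mul_apply, rep_simple_apply, map_sub, map_smul, rep_rep_inv,
    form_rep_left]

variable (cs)

theorem eq_one_of_rep_α_nonneg {g : W} (h : ∀ i, 0 ≤ rep cs g (α i)) : g = 1 := by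
  by_contra hg
  obtain ⟨j, hj⟩ := cs.exists_rightDescent_of_ne_one hg
  have hj' : cs.length (g * cs.simple j) < cs.length g := hj
  rcases rep_α_nonneg_or_nonpos cs g j with h1 | h1
  · omega
  · exact ((isRoot_α j).rep g).not_nonpos (h j) h1.2

theorem rep_faithful {g h : W} (hgh : ∀ x, rep cs g x = rep cs h x) : g = h := by
  have : h⁻¹ * g = 1 := eq_one_of_rep_α_nonneg cs fun i => by
    rw [rep_mul_apply, hgh, rep_inv_rep]; exact α_nonneg i
  exact (inv_mul_eq_one.mp this).symm

theorem rep_simple_apply_of_ne {i b : B} (h : b ≠ i) (x : B → ℝ) :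
    rep cs (cs.simple i) x b = x b := by
  rw [rep_simple_apply]; simp [α, h]

variable {cs}

theorem IsRoot.eq_α_of_simple_nonpos {x : B → ℝ} (hx : IsRoot cs x) (h0 : 0 ≤ x) {i : B}
    (h : CoxRank.rep cs (cs.simple i) x ≤ 0) : x = α i := by
  have hb : ∀ b, b ≠ i → x b = 0 := fun b hb => by
    have h1 := h b
    rw [rep_simple_apply_of_ne cs hb] at h1
    exact le_antisymm h1 (h0 b)
  have hxe : x = x i • α i := by
    funext b
    by_cases hbi : b = i
    · subst hbi; simp [α]
    · simp [α, hbi, hb b hbi]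
  have h2 := hx.form_self
  rw [hxe] at h2
  simp only [map_smul, LinearMap.smul_apply, form_α_α, entry_self, smul_eq_mul] at h2
  have h3 : 0 ≤ x i := h0 i
  have h4 : x i = 1 := by nlinarith
  rw [hxe, h4, one_smul]

theorem IsRoot.simple_nonneg {x : B → ℝ} (hx : IsRoot cs x) (h0 : 0 ≤ x) {i : B}
    (h : x ≠ α i) : 0 ≤ CoxRank.rep cs (cs.simple i) x :=
  (hx.rep _).not_nonpos_iff.mp fun h' => h (hx.eq_α_of_simple_nonpos h0 h')

variable (cs)

/-- The positive roots made negative by `g⁻¹`. -/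
def invSet (g : W) : Set (B → ℝ) := {x | IsRoot cs x ∧ 0 ≤ x ∧ rep cs g⁻¹ x ≤ 0}

theorem invSet_one : invSet cs (1 : W) = ∅ := by
  ext x
  simp only [invSet, Set.mem_ofPred_eq, inv_one, rep_one_apply, Set.mem_empty_iff_false, iff_false]
  rintro ⟨h1, h2, h3⟩
  exact h1.not_nonpos h2 h3

theorem invSet_mul_simple_subset (g : W) (i : B) :
    invSet cs (g * cs.simple i) ⊆ insert (rep cs g (α i)) (invSet cs g) := by
  rintro x ⟨h1, h2, h3⟩
  rw [mul_inv_rev, cs.inv_simple, rep_mul_apply] at h3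
  by_cases h : rep cs g⁻¹ x ≤ 0
  · exact Or.inr ⟨h1, h2, h⟩
  · left
    have := (h1.rep g⁻¹).eq_α_of_simple_nonpos ((h1.rep _).not_nonpos_iff.mp h) h3
    rw [← this, rep_rep_inv]

theorem finite_invSet (g : W) : (invSet cs g).Finite := by
  induction g using cs.simple_induction_right with
  | one => rw [invSet_one]; exact Set.finite_empty
  | mul_simple_right g i ih => exact (ih.insert _).subset (invSet_mul_simple_subset cs g i)

theorem length_le_ncard_invSet (g : W) : cs.length g ≤ (invSet cs g).ncard := by
  induction hn : cs.length g generalizing g with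
  | zero => exact Nat.zero_le _
  | succ n ih =>
    have hg : g ≠ 1 := by rintro rfl; simp at hn
    obtain ⟨i, hi⟩ := cs.exists_rightDescent_of_ne_one hg
    have hi' : cs.length (g * cs.simple i) < cs.length g := hi
    obtain ⟨h, rfl⟩ : ∃ h, g = h * cs.simple i := ⟨g * cs.simple i, by simp⟩
    rw [mul_assoc, cs.simple_mul_simple_self, mul_one] at hi'
    have hl : cs.length h = n := by
      rcases cs.length_mul_simple h i with h1 | h1 <;> omega
    have hpos := rep_α_nonneg cs h i hi'
    have hroot : IsRoot cs (rep cs h (α i)) := (isRoot_α i).rep h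
    have hmem : rep cs h (α i) ∉ invSet cs h := fun hx => by
      have := hx.2.2
      rw [rep_inv_rep] at this
      exact (isRoot_α (cs := cs) i).not_nonpos (α_nonneg i) this
    have hsub : insert (rep cs h (α i)) (invSet cs h) ⊆ invSet cs (h * cs.simple i) := by
      rintro x (rfl | ⟨h1, h2, h3⟩)
      · refine ⟨hroot, hpos, ?_⟩
        rw [mul_inv_rev, cs.inv_simple, rep_mul_apply, rep_inv_rep, rep_simple_α]
        have := α_nonneg i
        simpa using this
      · refine ⟨h1, h2, ?_⟩
        rw [mul_inv_rev, cs.inv_simple, rep_mul_apply]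
        have h4 : 0 ≤ rep cs (cs.simple i) (-(rep cs h⁻¹ x)) := by
          refine (h1.rep h⁻¹).neg.simple_nonneg (by simpa using h3) fun he => ?_
          have : x = -rep cs h (α i) := by rw [← he, map_neg, rep_rep_inv, neg_neg]
          rw [this] at h2
          exact hroot.not_nonpos hpos (by simpa using h2)
        rw [map_neg] at h4
        simpa using h4
    have := Set.ncard_le_ncard hsub (finite_invSet cs _)
    rw [Set.ncard_insert_of_notMem hmem (finite_invSet cs h)] at this
    have := ih h hl
    omega

theorem finite_length_le (n : ℕ) : {g : W | cs.length g ≤ n}.Finite := by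
  refine ((List.finite_length_le B n).image cs.wordProd).subset fun g hg => ?_
  obtain ⟨l, hl, rfl⟩ := cs.exists_isReduced g
  have hg' : cs.length (cs.wordProd l) ≤ n := hg
  rw [hl.eq] at hg'
  exact ⟨l, hg', rfl⟩

end Roots

section Limits

variable [Fintype B] [DecidableEq B] {cs : CoxeterSystem M W}

open Filter Topology

theorem forall_of_adjacent (hirr : cs.IsIrreducibleSystem) (T : B → Prop) {j : B} (hj : T j)
    (hstep : ∀ i j, T j → entry M i j ≠ 0 → T i) : ∀ i, T i := by
  have := hirr {i | T i} {i | ¬ T i} (by ext i; simp [em]) (by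
    rw [Set.disjoint_left]; intro i hi hi'; exact hi' hi) (by
    intro i hi k hk
    have h0 : entry M k i = 0 := by
      by_contra h
      exact hk (hstep k i hi h)
    have h2 := cs.simple_mul_simple_pow i k
    rw [M.symmetric i k, eq_two_of_entry_eq_zero h0, pow_two] at h2
    have h3 := eq_inv_of_mul_eq_one_left h2
    rw [mul_inv_rev, cs.inv_simple, cs.inv_simple] at h3
    exact h3)
  rcases this with h | h
  · exact absurd (show j ∈ {i | T i} from hj) (by rw [h]; simp)
  · intro i
    by_contra hi
    exact absurd (show i ∈ {i | ¬ T i} from hi) (by rw [h]; simp)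

theorem sum_pos_of_root {x : B → ℝ} (hx : IsRoot cs x) (h : 0 ≤ x) : 0 < ∑ i, x i := by
  refine lt_of_le_of_ne (Finset.sum_nonneg fun i _ => h i) fun h0 => hx.ne_zero ?_
  funext i
  exact (Finset.sum_eq_zero_iff_of_nonneg fun i _ => h i).mp h0.symm i (Finset.mem_univ i)

/-- Two roots with product at most `-2` are not simultaneously positive at one chamber and
simultaneously negative at another. -/
theorem not_nonpos_of_form_le {x y : B → ℝ} (hx : IsRoot cs x) (hy : IsRoot cs y)
    (hxy : form M x y ≤ -2) {g h : W} (gx : 0 ≤ rep cs g x) (gy : 0 ≤ rep cs g y)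
    (hx' : rep cs h x ≤ 0) (hy' : rep cs h y ≤ 0) : False := by
  let S : Set (B → ℝ) := {z | IsRoot cs z ∧ ∃ p q : ℝ, 0 ≤ q ∧ q < p ∧ z = p • x + q • y}
  have hSsub : S ⊆ rep cs g⁻¹ '' invSet cs (g * h⁻¹) := by
    rintro z ⟨hz, p, q, hq, hpq, rfl⟩
    refine ⟨rep cs g (p • x + q • y), ⟨hz.rep g, ?_, ?_⟩, rep_inv_rep ..⟩
    · rw [map_add, map_smul, map_smul]
      exact add_nonneg (smul_nonneg (by linarith) gx) (smul_nonneg hq gy)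
    · rw [mul_inv_rev, inv_inv, rep_mul_apply, rep_inv_rep, map_add, map_smul, map_smul]
      exact add_nonpos (smul_nonpos_of_nonneg_of_nonpos (by linarith) hx')
        (smul_nonpos_of_nonneg_of_nonpos hq hy')
  have hS : S.Finite := ((finite_invSet cs _).image _).subset hSsub
  obtain ⟨z, ⟨hz, p, q, hq, hpq, hzpq⟩, hmax⟩ :=
    Set.exists_max_image S (fun z => ∑ i, rep cs g z i) hS
      ⟨x, hx, 1, 0, le_rfl, one_pos, by simp⟩
  obtain ⟨rx, hrx⟩ := hx.exists_reflection
  obtain ⟨ry, hry⟩ := hy.exists_reflection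
  set c := -form M x y with hc
  have hc2 : 2 ≤ c := by linarith
  set q' := p * c - q with hq'
  set p' := q' * c - p with hp'
  have hqq : p < q' := by nlinarith
  have hpp : q' < p' := by nlinarith
  have hxyc : form M x y = -c := by rw [hc]; ring
  have e : rep cs rx (rep cs ry z) = p' • x + q' • y := by
    rw [hry, hrx, hzpq]
    simp only [map_add, map_sub, map_smul, smul_eq_mul, hx.form_self, hy.form_self,
      form_comm y x, hxyc]
    rw [hp', hq']
    module
  have := hmax (p' • x + q' • y) ⟨e ▸ (hz.rep ry).rep rx, p', q', by linarith, hpp, rfl⟩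
  simp only [hzpq, map_add, map_smul, Pi.add_apply, Pi.smul_apply, smul_eq_mul,
    Finset.sum_add_distrib, ← Finset.mul_sum] at this
  have s1 := sum_pos_of_root (hx.rep g) gx
  have s2 := sum_pos_of_root (hy.rep g) gy
  nlinarith

theorem tendsto_form {ι : Type*} {l : Filter ι} {f g : ι → B → ℝ} {x y : B → ℝ}
    (hf : Tendsto f l (𝓝 x)) (hg : Tendsto g l (𝓝 y)) :
    Tendsto (fun n => form M (f n) (g n)) l (𝓝 (form M x y)) := by
  simp only [form_apply]
  exact tendsto_finsetSum _ fun i _ => tendsto_finsetSum _ fun j _ =>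
    (tendsto_const_nhds.mul (tendsto_pi_nhds.mp hf i)).mul (tendsto_pi_nhds.mp hg j)

theorem continuous_rep (g : W) : Continuous (rep cs g) :=
  LinearMap.continuous_of_finiteDimensional _

theorem eq_of_reflections_eq {x y : B → ℝ} (hx : IsRoot cs x) (hx0 : 0 ≤ x)
    (hy0 : 0 ≤ y) (h : ∀ z, z - form M x z • x = z - form M y z • y) : x = y := by
  have h1 := h x
  rw [hx.form_self] at h1
  have h2 : (2 : ℝ) • x = form M y x • y := sub_right_injective h1
  have h4 := congrArg (form M x) h2
  simp only [map_smul, smul_eq_mul, hx.form_self, form_comm x y] at h4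
  have h5 : form M y x = 2 ∨ form M y x = -2 := by
    have : (form M y x - 2) * (form M y x + 2) = 0 := by linarith
    rcases mul_eq_zero.mp this with h | h
    · left; linarith
    · right; linarith
  rcases h5 with h5 | h5
  · rw [h5] at h2
    exact smul_right_injective _ (two_ne_zero) h2
  · rw [h5, neg_smul, ← smul_neg] at h2
    have h6 : x = -y := smul_right_injective _ (two_ne_zero) h2
    exact absurd (by rw [h6]; simpa using hy0) (hx.not_nonpos hx0)

theorem finite_pos_roots_norm_le (cs : CoxeterSystem M W) (R : ℝ) :
    {x | IsRoot cs x ∧ 0 ≤ x ∧ ‖x‖ ≤ R}.Finite := by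
  by_contra hfin
  have hinf : {x | IsRoot cs x ∧ 0 ≤ x ∧ ‖x‖ ≤ R}.Infinite := hfin
  let e := hinf.natEmbedding
  obtain ⟨b, -, φ, hφ, hlim⟩ := tendsto_subseq_of_bounded
    (Metric.isBounded_closedBall (x := (0 : B → ℝ)) (r := R))
    (x := fun n => (e n : B → ℝ)) (fun n => by simpa using (e n).2.2.2)
  set β : ℕ → B → ℝ := fun n => e (φ n) with hβ
  have hroot : ∀ n, IsRoot cs (β n) := fun n => (e (φ n)).2.1
  have hpos : ∀ n, 0 ≤ β n := fun n => (e (φ n)).2.2.1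
  have hinj : ∀ n, β n ≠ β (n + 1) := fun n h => by
    have := hφ.injective (e.injective (Subtype.ext h))
    omega
  have hβ1 : Tendsto β atTop (𝓝 b) := hlim
  have hβ2 : Tendsto (fun n => β (n + 1)) atTop (𝓝 b) := (tendsto_add_atTop_iff_nat 1).mpr hβ1
  choose r hr using fun n => (hroot n).exists_reflection
  have hbb : form M b b = 2 := by
    refine tendsto_nhds_unique (tendsto_form hβ1 hβ1) ?_
    simp only [(hroot _).form_self]
    exact tendsto_const_nhds
  have hlim2 : ∀ i, Tendsto (fun n => rep cs (r n * r (n + 1)) (α i)) atTop (𝓝 (α i)) := by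
    intro i
    have t1 : Tendsto (fun n => rep cs (r (n + 1)) (α i)) atTop
        (𝓝 (α i - form M b (α i) • b)) := by
      simp only [hr]
      exact tendsto_const_nhds.sub ((tendsto_form hβ2 tendsto_const_nhds).smul hβ2)
    have t2 : Tendsto (fun n => rep cs (r n * r (n + 1)) (α i)) atTop
        (𝓝 ((α i - form M b (α i) • b) - form M b (α i - form M b (α i) • b) • b)) := by
      simp only [rep_mul_apply]
      simp only [hr] at t1 ⊢
      exact t1.sub ((tendsto_form hβ1 t1).smul hβ1)
    convert t2 using 2
    rw [map_sub, map_smul, hbb]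
    simp only [smul_eq_mul]
    module
  have hev : ∀ᶠ n in atTop, ∀ i, 0 ≤ rep cs (r n * r (n + 1)) (α i) := by
    rw [Filter.eventually_all]
    intro i
    have t : Tendsto (fun n => ∑ j, rep cs (r n * r (n + 1)) (α i) j) atTop
        (𝓝 (∑ j, (α i : B → ℝ) j)) :=
      tendsto_finsetSum _ fun j _ => (tendsto_pi_nhds.mp (hlim2 i)) j
    have hs := sum_pos_of_root (isRoot_α (cs := cs) i) (α_nonneg i)
    filter_upwards [t.eventually (lt_mem_nhds hs)] with n hn
    refine ((isRoot_α i).rep _).not_nonpos_iff.mp fun h => ?_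
    exact absurd hn (not_lt.mpr (Finset.sum_nonpos fun j _ => h j))
  obtain ⟨n, hn⟩ := hev.exists
  have h1 := eq_one_of_rep_α_nonneg cs hn
  have hrr : r n * r n = 1 := by
    refine rep_faithful cs fun x => ?_
    rw [rep_mul_apply, hr, hr, map_sub, map_smul, (hroot n).form_self, rep_one_apply]
    simp only [smul_eq_mul]
    module
  have h2 : r n = r (n + 1) := mul_left_cancel (hrr.trans h1.symm)
  refine hinj n (eq_of_reflections_eq (hroot n) (hpos n) (hpos _) fun z => ?_)
  rw [← hr, ← hr, h2]

theorem tendsto_norm_of_injective {β : ℕ → B → ℝ} (hβ : ∀ n, IsRoot cs (β n))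
    (hpos : ∀ n, 0 ≤ β n) (hinj : Function.Injective β) :
    Tendsto (fun n => ‖β n‖) atTop atTop := by
  rw [tendsto_atTop]
  intro R
  have hfin := (finite_pos_roots_norm_le cs R).preimage (f := β) hinj.injOn
  have := hfin.eventually_cofinite_notMem
  rw [Nat.cofinite_eq_atTop] at this
  filter_upwards [this] with n hn
  by_contra h
  exact hn ⟨hβ n, hpos n, (not_le.mp h).le⟩

/-- Limit directions of positive roots lie in every translate of the positive cone. -/
theorem exists_limit {β : ℕ → B → ℝ} (hβ : ∀ n, IsRoot cs (β n))
    (hpos : ∀ n, 0 ≤ β n) (hnorm : Tendsto (fun n => ‖β n‖) atTop atTop) :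
    ∃ (v : B → ℝ) (φ : ℕ → ℕ), StrictMono φ ∧ v ≠ 0 ∧
      Tendsto (fun n => ‖β (φ n)‖⁻¹ • β (φ n)) atTop (𝓝 v) ∧
      Tendsto (fun n => ‖β (φ n)‖) atTop atTop ∧ ∀ g, 0 ≤ rep cs g v := by
  have hne : ∀ n, ‖β n‖ ≠ 0 := fun n => norm_ne_zero_iff.mpr (hβ n).ne_zero
  have hn1 : ∀ n, ‖‖β n‖⁻¹ • β n‖ = 1 := fun n => by
    rw [norm_smul, norm_inv, norm_norm, inv_mul_cancel₀ (hne n)]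
  obtain ⟨v, -, φ, hφ, hlim⟩ := tendsto_subseq_of_bounded
    (Metric.isBounded_closedBall (x := (0 : B → ℝ)) (r := 1))
    (x := fun n => ‖β n‖⁻¹ • β n) (fun n => by
      rw [mem_closedBall_zero_iff, hn1])
  have hnφ := hnorm.comp hφ.tendsto_atTop
  refine ⟨v, φ, hφ, ?_, hlim, hnφ, fun g => ?_⟩
  · have : Tendsto (fun n => ‖‖β (φ n)‖⁻¹ • β (φ n)‖) atTop (𝓝 ‖v‖) := hlim.norm
    simp only [hn1] at this
    have h1 := tendsto_nhds_unique this tendsto_const_nhds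
    intro h; rw [h] at h1; simp at h1
  · have hlim' := ((continuous_rep (cs := cs) g).tendsto v).comp hlim
    refine ge_of_tendsto hlim' ?_
    obtain ⟨R, hR⟩ := (finite_invSet cs g⁻¹).isBounded.exists_norm_le
    filter_upwards [hnφ.eventually_gt_atTop R] with n hn
    simp only [Function.comp_apply, map_smul] at hn ⊢
    refine smul_nonneg (by positivity) (((hβ _).rep g).not_nonpos_iff.mp fun h => ?_)
    exact absurd (hR (β (φ n)) ⟨hβ _, hpos _, by rwa [inv_inv]⟩) (not_le.mpr hn)

theorem infinite_pos_roots (cs : CoxeterSystem M W) [Infinite W] :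
    {x | IsRoot cs x ∧ 0 ≤ x}.Infinite := by
  intro hfin
  refine Set.infinite_univ (α := W) ((finite_length_le cs
    {x | IsRoot cs x ∧ 0 ≤ x}.ncard).subset fun g _ => ?_)
  exact (length_le_ncard_invSet cs g).trans (Set.ncard_le_ncard (fun x hx => ⟨hx.1, hx.2.1⟩) hfin)

theorem exists_limit_vector (cs : CoxeterSystem M W) [Infinite W] :
    ∃ v : B → ℝ, v ≠ 0 ∧ ∀ g, 0 ≤ rep cs g v := by
  let e := (infinite_pos_roots cs).natEmbedding
  obtain ⟨v, -, -, hv, -, -, h⟩ := exists_limit (cs := cs) (β := fun n => (e n : B → ℝ))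
    (fun n => (e n).2.1) (fun n => (e n).2.2)
    (tendsto_norm_of_injective (fun n => (e n).2.1) (fun n => (e n).2.2)
      fun _ _ h => e.injective (Subtype.ext h))
  exact ⟨v, hv, h⟩

end Limits

section Affine

variable [Fintype B] [DecidableEq B] {cs : CoxeterSystem M W}

open Filter Topology

theorem eq_sum_smul_α (x : B → ℝ) : x = ∑ i, x i • (α i : B → ℝ) := by
  funext b
  simp [α, Finset.sum_apply, Pi.single_apply]

theorem linear_apply (f : (B → ℝ) →ₗ[ℝ] ℝ) (x : B → ℝ) : f x = ∑ i, x i * f (α i) := by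
  conv_lhs => rw [eq_sum_smul_α x]
  simp

theorem radical_pos (hirr : cs.IsIrreducibleSystem) {y : B → ℝ} (hy0 : 0 ≤ y) (hy : y ≠ 0)
    (hker : ∀ x, form M x y = 0) : ∀ i, 0 < y i := by
  obtain ⟨j, hj⟩ : ∃ j, y j ≠ 0 := by
    by_contra h; push Not at h; exact hy (funext h)
  have hj' : 0 < y j := lt_of_le_of_ne (hy0 j) hj.symm
  refine forall_of_adjacent hirr (fun i => 0 < y i) hj' fun i k hk hik => ?_
  by_contra hi
  have hi0 : y i = 0 := le_antisymm (not_lt.mp hi) (hy0 i)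
  have h := hker (α i)
  rw [form_α_left] at h
  have h2 := (Finset.sum_eq_zero_iff_of_nonpos (fun m _ => by
    by_cases hm : i = m
    · subst hm; simp [hi0]
    · exact mul_nonpos_of_nonpos_of_nonneg (entry_nonpos hm) (hy0 m))).mp h k (Finset.mem_univ k)
  rcases mul_eq_zero.mp h2 with h3 | h3
  · exact hik h3
  · exact hk.ne' h3

theorem form_self_eq {y : B → ℝ} (hpos : ∀ i, 0 < y i) (hker : ∀ x, form M x y = 0)
    (x : B → ℝ) :
    2 * form M x x = ∑ i, ∑ j, -entry M i j * y i * y j * (x i / y i - x j / y j) ^ 2 := by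
  have hrow : ∀ i, ∑ j, entry M i j * y j = 0 := fun i => by rw [← form_α_left, hker]
  have e : ∀ i j, -entry M i j * y i * y j * (x i / y i - x j / y j) ^ 2 =
      2 * (entry M i j * x i * x j) - x i ^ 2 / y i * (entry M i j * y j) -
        x j ^ 2 / y j * (entry M j i * y i) := fun i j => by
    have := (hpos i).ne'
    have := (hpos j).ne'
    rw [entry_comm j i]
    field_simp
    ring
  simp only [e, Finset.sum_sub_distrib, ← Finset.mul_sum, hrow, mul_zero]
  rw [Finset.sum_comm (f := fun i j => x j ^ 2 / y j * (entry M j i * y i))]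
  simp only [← Finset.mul_sum, hrow, mul_zero, form_apply]
  simp

theorem form_term_nonneg {y : B → ℝ} (hpos : ∀ i, 0 < y i) (x : B → ℝ) (i j : B) :
    0 ≤ -entry M i j * y i * y j * (x i / y i - x j / y j) ^ 2 := by
  by_cases hij : i = j
  · subst hij; simp
  · have h1 := entry_nonpos (M := M) hij
    have h2 := hpos i
    have h3 := hpos j
    have : 0 ≤ -entry M i j := by linarith
    positivity

theorem form_self_nonneg {y : B → ℝ} (hpos : ∀ i, 0 < y i) (hker : ∀ x, form M x y = 0)
    (x : B → ℝ) : 0 ≤ form M x x := by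
  have h := form_self_eq hpos hker x
  have : 0 ≤ 2 * form M x x := by
    rw [h]
    exact Finset.sum_nonneg fun i _ => Finset.sum_nonneg fun j _ => form_term_nonneg hpos x i j
  linarith

theorem form_self_pos (hirr : cs.IsIrreducibleSystem) {y : B → ℝ} (hpos : ∀ i, 0 < y i)
    (hker : ∀ x, form M x y = 0) {x : B → ℝ} {j : B} (hx : x ≠ 0) (hj : x j = 0) :
    0 < form M x x := by
  refine lt_of_le_of_ne (form_self_nonneg hpos hker x) fun h0 => hx ?_
  have h := form_self_eq hpos hker x
  rw [← h0, mul_zero] at h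
  have h1 := fun i => (Finset.sum_eq_zero_iff_of_nonneg fun i _ =>
    Finset.sum_nonneg fun j _ => form_term_nonneg hpos x i j).mp h.symm i (Finset.mem_univ i)
  have h2 := fun i k => (Finset.sum_eq_zero_iff_of_nonneg fun j _ =>
    form_term_nonneg hpos x i j).mp (h1 i) k (Finset.mem_univ k)
  have h3 := forall_of_adjacent hirr (fun i => x i = 0) hj fun i k hk hik => by
    have h4 := h2 i k
    rw [hk, zero_div, sub_zero] at h4
    have h5 := (hpos i).ne'
    have h6 := (hpos k).ne'
    have h7 : -entry M i k * y i * y k ≠ 0 := mul_ne_zero (mul_ne_zero (neg_ne_zero.mpr hik) h5) h6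
    have h8 := (mul_eq_zero.mp h4).resolve_left h7
    have h9 := pow_eq_zero_iff (two_ne_zero) |>.mp h8
    exact (div_eq_zero_iff.mp h9).resolve_right h5
  exact funext h3

theorem bounded_of_form_le (hirr : cs.IsIrreducibleSystem) {y : B → ℝ} (hpos : ∀ i, 0 < y i)
    (hker : ∀ x, form M x y = 0) (j : B) :
    ∃ R, ∀ x : B → ℝ, x j = 0 → form M x x ≤ 2 → ‖x‖ ≤ R := by
  have hcont : Continuous fun x : B → ℝ => form M x x := by
    simp only [form_apply]; fun_prop
  have hK : IsCompact (Metric.sphere (0 : B → ℝ) 1 ∩ {x | x j = 0}) :=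
    (isCompact_sphere _ _).inter_right (isClosed_eq (continuous_apply j) continuous_const)
  rcases (Metric.sphere (0 : B → ℝ) 1 ∩ {x | x j = 0}).eq_empty_or_nonempty with he | hne
  · refine ⟨0, fun x hx _ => ?_⟩
    by_contra hx0
    have hx1 : ‖x‖ ≠ 0 := fun h => hx0 h.le
    have : ‖x‖⁻¹ • x ∈ Metric.sphere (0 : B → ℝ) 1 ∩ {x | x j = 0} := by
      refine ⟨?_, ?_⟩
      · rw [mem_sphere_zero_iff_norm, norm_smul, norm_inv, norm_norm, inv_mul_cancel₀ hx1]
      · show (‖x‖⁻¹ • x) j = 0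
        simp [hx]
    rw [he] at this
    exact this
  · obtain ⟨m, hm, hmin⟩ := hK.exists_isMinOn hne hcont.continuousOn
    have hm0 : 0 < form M m m := form_self_pos hirr hpos hker (by
      rintro rfl
      have := hm.1
      simp at this) hm.2
    set μ := form M m m with hμ
    refine ⟨Real.sqrt (2 / μ), fun x hx hx2 => ?_⟩
    by_cases hx0 : x = 0
    · rw [hx0, norm_zero]; exact Real.sqrt_nonneg _
    have hx1 : ‖x‖ ≠ 0 := norm_ne_zero_iff.mpr hx0
    have hmem : ‖x‖⁻¹ • x ∈ Metric.sphere (0 : B → ℝ) 1 ∩ {x | x j = 0} := by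
      refine ⟨?_, ?_⟩
      · rw [mem_sphere_zero_iff_norm, norm_smul, norm_inv, norm_norm, inv_mul_cancel₀ hx1]
      · show (‖x‖⁻¹ • x) j = 0
        simp [hx]
    have h1 : μ ≤ form M (‖x‖⁻¹ • x) (‖x‖⁻¹ • x) := hmin hmem
    simp only [map_smul, LinearMap.smul_apply, smul_eq_mul] at h1
    apply Real.le_sqrt_of_sq_le
    rw [le_div_iff₀ hm0]
    have h2 : ‖x‖ ^ 2 * μ ≤ ‖x‖ ^ 2 * (‖x‖⁻¹ * (‖x‖⁻¹ * form M x x)) :=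
      mul_le_mul_of_nonneg_left h1 (by positivity)
    have h3 : ‖x‖ ^ 2 * (‖x‖⁻¹ * (‖x‖⁻¹ * form M x x)) = form M x x := by
      field_simp
    linarith

theorem rep_radical (cs : CoxeterSystem M W) {y : B → ℝ} (hker : ∀ x, form M x y = 0) (g : W) :
    rep cs g y = y := by
  induction g using cs.simple_induction_left with
  | one => simp
  | mul_simple_left g i ih => rw [rep_mul_apply, ih, rep_simple_apply, hker, zero_smul, sub_zero]

theorem finite_roots_norm_le (cs : CoxeterSystem M W) (R : ℝ) :
    {x | IsRoot cs x ∧ ‖x‖ ≤ R}.Finite := by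
  refine ((finite_pos_roots_norm_le cs R).union
    ((finite_pos_roots_norm_le cs R).image Neg.neg)).subset ?_
  rintro x ⟨hx, hR⟩
  rcases hx.nonneg_or_nonpos with h | h
  · exact Or.inl ⟨hx, h, hR⟩
  · exact Or.inr ⟨-x, ⟨hx.neg, by simpa using h, by simpa using hR⟩, neg_neg x⟩

theorem exists_nonneg_translate {f : (B → ℝ) →ₗ[ℝ] ℝ}
    (hfin : {x | IsRoot cs x ∧ 0 ≤ x ∧ f x < 0}.Finite) :
    ∃ g, ∀ i, 0 ≤ f (rep cs g (α i)) := by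
  induction hn : {x | IsRoot cs x ∧ 0 ≤ x ∧ f x < 0}.ncard using Nat.strong_induction_on
    generalizing f with
  | _ n ih =>
  subst hn
  by_cases h : ∀ i, 0 ≤ f (α i)
  · exact ⟨1, by simpa using h⟩
  push Not at h
  obtain ⟨i, hi⟩ := h
  set f' := f ∘ₗ rep cs (cs.simple i) with hf'
  have hsub : rep cs (cs.simple i) '' {x | IsRoot cs x ∧ 0 ≤ x ∧ f' x < 0} ⊆
      {x | IsRoot cs x ∧ 0 ≤ x ∧ f x < 0} \ {α i} := by
    rintro _ ⟨x, ⟨h1, h2, h3⟩, rfl⟩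
    have hxi : x ≠ α i := by
      rintro rfl
      rw [hf', LinearMap.comp_apply, rep_simple_α, map_neg] at h3
      linarith
    refine ⟨⟨h1.rep _, h1.simple_nonneg h2 hxi, h3⟩, fun he => ?_⟩
    have he' : rep cs (cs.simple i) x = α i := he
    have : x = -α i := by
      rw [← rep_inv_rep cs (cs.simple i) x, he', cs.inv_simple, rep_simple_α]
    rw [this] at h2 h1
    exact h1.not_nonpos h2 (by simpa using α_nonneg i)
  have hlt : ({x | IsRoot cs x ∧ 0 ≤ x ∧ f x < 0} \ {α i}).ncard <
      {x | IsRoot cs x ∧ 0 ≤ x ∧ f x < 0}.ncard :=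
    Set.ncard_sdiff_singleton_lt_of_mem ⟨isRoot_α i, α_nonneg i, hi⟩ hfin
  have hfin' : {x | IsRoot cs x ∧ 0 ≤ x ∧ f' x < 0}.Finite :=
    Set.Finite.of_finite_image ((hfin.subset Set.sdiff_subset).subset hsub)
      (rep_injective cs _).injOn
  have hle := Set.ncard_le_ncard hsub (hfin.subset Set.sdiff_subset)
  rw [Set.ncard_image_of_injective _ (rep_injective cs _)] at hle
  obtain ⟨g, hg⟩ := ih _ (hle.trans_lt hlt) hfin' rfl
  exact ⟨cs.simple i * g, fun k => by rw [rep_mul_apply]; exact hg k⟩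

theorem exists_coord_eq_zero (hirr : cs.IsIrreducibleSystem) {y : B → ℝ} (hpos : ∀ i, 0 < y i)
    (hy : y ≠ 0) (hker : ∀ x, form M x y = 0) {β γ : B → ℝ} (hβ : IsRoot cs β)
    (hγ : IsRoot cs γ) (hlt : |form M β γ| < 2) :
    ∃ g j, rep cs g β j = 0 ∧ rep cs g γ j = 0 := by
  have hnot : y ∉ Submodule.span ℝ {β, γ} := by
    intro hmem
    obtain ⟨p, q, hpq⟩ := Submodule.mem_span_pair.mp hmem
    have h1 := hker β
    have h2 := hker γ
    rw [← hpq] at h1 h2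
    simp only [map_add, map_smul, smul_eq_mul, hβ.form_self, hγ.form_self, form_comm γ β] at h1 h2
    have h3 : form M β γ ^ 2 < 4 := by
      have := sq_lt_sq' (abs_lt.mp hlt).1 (abs_lt.mp hlt).2
      linarith
    have hp : p = 0 := by
      have : p * (4 - form M β γ ^ 2) = 0 := by linear_combination 2 * h1 - form M β γ * h2
      exact (mul_eq_zero.mp this).resolve_right (by linarith)
    have hq : q = 0 := by
      rw [hp] at h2; linarith
    rw [hp, hq] at hpq
    simp at hpq
    exact hy hpq.symm
  obtain ⟨f₀, hf₀, hle⟩ := Submodule.exists_le_ker_of_notMem hnot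
  have hβ0 : f₀ β = 0 := hle (Submodule.subset_span (by simp))
  have hγ0 : f₀ γ = 0 := hle (Submodule.subset_span (by simp))
  set f : (B → ℝ) →ₗ[ℝ] ℝ := (f₀ y)⁻¹ • f₀ with hf
  have hfβ : f β = 0 := by simp [hf, hβ0]
  have hfγ : f γ = 0 := by simp [hf, hγ0]
  have hfy : f y = 1 := by simp [hf, hf₀]
  obtain ⟨j₀, -⟩ : ∃ j, y j ≠ 0 := by
    by_contra h; push Not at h; exact hy (funext h)
  have hyj := hpos j₀
  obtain ⟨R, hR⟩ := bounded_of_form_le hirr hpos hker j₀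
  let F : (B → ℝ) →L[ℝ] ℝ := LinearMap.toContinuousLinearMap f
  have hfin : {x | IsRoot cs x ∧ 0 ≤ x ∧ f x < 0}.Finite := by
    refine (finite_roots_norm_le cs (‖F‖ * R * ‖y‖ + R)).subset ?_
    rintro x ⟨h1, h2, h3⟩
    refine ⟨h1, ?_⟩
    set t := x j₀ / y j₀ with ht
    have ht0 : 0 ≤ t := div_nonneg (h2 j₀) hyj.le
    set z := x - t • y with hz
    have hzR : ‖z‖ ≤ R := hR z (by
      rw [hz, ht]; simp [div_mul_cancel₀ _ hyj.ne']) (by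
      rw [hz]
      simp only [map_sub, map_smul, LinearMap.sub_apply, LinearMap.smul_apply, smul_eq_mul, hker,
        form_comm y x, h1.form_self]
      simp)
    have hxz : x = t • y + z := by rw [hz]; abel
    have hfz : t < ‖F‖ * R := by
      have h4 : f x = t + f z := by rw [hxz, map_add, map_smul, hfy]; simp
      have h5 : ‖F z‖ ≤ ‖F‖ * ‖z‖ := F.le_opNorm z
      have h6 : -f z ≤ ‖F z‖ := neg_le_abs (f z)
      have h7 : ‖F‖ * ‖z‖ ≤ ‖F‖ * R := mul_le_mul_of_nonneg_left hzR (norm_nonneg _)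
      linarith
    calc ‖x‖ = ‖t • y + z‖ := by rw [← hxz]
      _ ≤ ‖t • y‖ + ‖z‖ := norm_add_le _ _
      _ = t * ‖y‖ + ‖z‖ := by rw [norm_smul, Real.norm_of_nonneg ht0]
      _ ≤ ‖F‖ * R * ‖y‖ + R := by gcongr
  obtain ⟨g, hg⟩ := exists_nonneg_translate hfin
  obtain ⟨j, hj⟩ : ∃ j, 0 < f (rep cs g (α j)) := by
    by_contra hcon
    push Not at hcon
    have h1 : f (rep cs g y) = 1 := by rw [rep_radical cs hker, hfy]
    have h2 := linear_apply (f ∘ₗ rep cs g) y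
    rw [LinearMap.comp_apply, h1] at h2
    have : ∑ i, y i * (f ∘ₗ rep cs g) (α i) ≤ 0 := Finset.sum_nonpos fun i _ =>
      mul_nonpos_of_nonneg_of_nonpos (hpos i).le (hcon i)
    linarith
  have key : ∀ δ, IsRoot cs δ → f δ = 0 → rep cs g⁻¹ δ j = 0 := fun δ hδ hfδ => by
    have h2 := linear_apply (f ∘ₗ rep cs g) (rep cs g⁻¹ δ)
    rw [LinearMap.comp_apply, rep_rep_inv, hfδ] at h2
    have h3 : rep cs g⁻¹ δ j * (f ∘ₗ rep cs g) (α j) = 0 := by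
      rcases (hδ.rep g⁻¹).nonneg_or_nonpos with h | h
      · exact (Finset.sum_eq_zero_iff_of_nonneg fun i _ => mul_nonneg (h i) (hg i)).mp h2.symm j
          (Finset.mem_univ j)
      · exact (Finset.sum_eq_zero_iff_of_nonpos fun i _ =>
          mul_nonpos_of_nonpos_of_nonneg (h i) (hg i)).mp h2.symm j (Finset.mem_univ j)
    exact (mul_eq_zero.mp h3).resolve_right hj.ne'
  exact ⟨g⁻¹, j, key β hβ hfβ, key γ hγ hfγ⟩

theorem finite_small_form_values (hirr : cs.IsIrreducibleSystem) {y : B → ℝ}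
    (hpos : ∀ i, 0 < y i) (hy : y ≠ 0) (hker : ∀ x, form M x y = 0) :
    {t : ℝ | |t| < 2 ∧ ∃ β γ, IsRoot cs β ∧ IsRoot cs γ ∧ t = form M β γ}.Finite := by
  have hF : {x | IsRoot cs x ∧ ∃ j, x j = 0}.Finite := by
    choose R hR using bounded_of_form_le hirr hpos hker
    have : (⋃ j, {x | IsRoot cs x ∧ ‖x‖ ≤ R j}).Finite :=
      Set.finite_iUnion fun j => finite_roots_norm_le cs (R j)
    refine this.subset ?_
    rintro x ⟨hx, j, hj⟩
    exact Set.mem_iUnion.mpr ⟨j, hx, hR j x hj hx.form_self.le⟩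
  refine ((hF.prod hF).image fun p => form M p.1 p.2).subset ?_
  rintro t ⟨ht, β, γ, hβ, hγ, rfl⟩
  obtain ⟨g, j, h1, h2⟩ := exists_coord_eq_zero hirr hpos hy hker hβ hγ ht
  exact ⟨(rep cs g β, rep cs g γ), ⟨⟨hβ.rep g, j, h1⟩, ⟨hγ.rep g, j, h2⟩⟩, form_rep_rep ..⟩

theorem finite_projected_roots (hirr : cs.IsIrreducibleSystem) {y : B → ℝ}
    (hpos : ∀ i, 0 < y i) (hy : y ≠ 0) (hker : ∀ x, form M x y = 0) (j : B) :
    {x | ∃ β, IsRoot cs β ∧ x = β - (β j / y j) • y}.Finite := by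
  by_contra hfin
  have hinf : {x | ∃ β, IsRoot cs β ∧ x = β - (β j / y j) • y}.Infinite := hfin
  let e := hinf.natEmbedding
  have hyj := (hpos j).ne'
  choose β₀ hβ₀ he using fun n => (e n).2
  have hform₀ : ∀ n m, form M (e n : B → ℝ) (e m : B → ℝ) = form M (β₀ n) (β₀ m) := fun n m => by
    rw [he n, he m]
    simp only [map_sub, map_smul, LinearMap.sub_apply, LinearMap.smul_apply, smul_eq_mul, hker,
      form_comm y]
    simp
  have hej : ∀ n, (e n : B → ℝ) j = 0 := fun n => by
    rw [he n]; simp [div_mul_cancel₀ _ hyj]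
  obtain ⟨R, hR⟩ := bounded_of_form_le hirr hpos hker j
  obtain ⟨b, -, φ, hφ, hlim⟩ := tendsto_subseq_of_bounded
    (Metric.isBounded_closedBall (x := (0 : B → ℝ)) (r := R))
    (x := fun n => (e n : B → ℝ)) (fun n => by
      rw [mem_closedBall_zero_iff]
      exact hR _ (hej n) (by rw [hform₀, (hβ₀ n).form_self]))
  set x : ℕ → B → ℝ := fun n => e (φ n) with hx
  have hx1 : Tendsto x atTop (𝓝 b) := hlim
  have hx2 : Tendsto (fun n => x (n + 1)) atTop (𝓝 b) := (tendsto_add_atTop_iff_nat 1).mpr hx1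
  have hxx : ∀ n, form M (x n) (x n) = 2 := fun n => by
    rw [hx]; simp only; rw [hform₀, (hβ₀ _).form_self]
  have hbb : form M b b = 2 := by
    refine tendsto_nhds_unique (tendsto_form hx1 hx1) ?_
    simp only [hxx]
    exact tendsto_const_nhds
  have ht := tendsto_form (M := M) hx1 hx2
  rw [hbb] at ht
  have hlt : ∀ n, form M (x n) (x (n + 1)) < 2 := fun n => by
    have hne : x n - x (n + 1) ≠ 0 := fun h => by
      have := hφ.injective (e.injective (Subtype.ext (sub_eq_zero.mp h)))
      omega
    have h1 := form_self_pos hirr hpos hker (j := j) hne (by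
      rw [hx]; simp [hej])
    simp only [map_sub, LinearMap.sub_apply, hxx, form_comm (x (n + 1)) (x n)] at h1
    linarith
  have hmem : ∀ᶠ n in atTop, form M (x n) (x (n + 1)) ∈
      {t : ℝ | |t| < 2 ∧ ∃ β γ, IsRoot cs β ∧ IsRoot cs γ ∧ t = form M β γ} := by
    filter_upwards [ht.eventually (lt_mem_nhds (show (-2 : ℝ) < 2 by norm_num))] with n hn
    exact ⟨abs_lt.mpr ⟨hn, hlt n⟩, β₀ (φ n), β₀ (φ (n + 1)), hβ₀ _, hβ₀ _, hform₀ _ _⟩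
  have := (finite_small_form_values (cs := cs) hirr hpos hy hker).isClosed.mem_of_tendsto ht hmem
  have h2 := this.1
  norm_num at h2

/-- If the form has a nonzero nonnegative vector in its radical then the group is virtually
abelian. -/
theorem virtually_abelian (hirr : cs.IsIrreducibleSystem) {y : B → ℝ} (hy0 : 0 ≤ y) (hy : y ≠ 0)
    (hker : ∀ x, form M x y = 0) :
    ∃ A : Subgroup W, (∀ x ∈ A, ∀ y ∈ A, Commute x y) ∧ A.FiniteIndex := by
  have hpos := radical_pos hirr hy0 hy hker
  obtain ⟨j, -⟩ : ∃ j, y j ≠ 0 := by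
    by_contra h; push Not at h; exact hy (funext h)
  let A : Subgroup W :=
    { carrier := {g | ∀ x, ∃ c : ℝ, rep cs g x = x + c • y}
      one_mem' := fun x => ⟨0, by simp⟩
      mul_mem' := by
        intro g h hg hh x
        obtain ⟨c, hc⟩ := hh x
        obtain ⟨d, hd⟩ := hg x
        refine ⟨c + d, ?_⟩
        rw [rep_mul_apply, hc, map_add, map_smul, hd, rep_radical cs hker]
        module
      inv_mem' := by
        intro g hg x
        obtain ⟨c, hc⟩ := hg (rep cs g⁻¹ x)
        refine ⟨-c, ?_⟩
        rw [rep_rep_inv] at hc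
        nth_rw 2 [hc]
        module }
  refine ⟨A, fun g hg h hh => ?_, ?_⟩
  · refine rep_faithful cs fun x => ?_
    obtain ⟨c, hc⟩ := hh x
    obtain ⟨d, hd⟩ := hg x
    rw [rep_mul_apply, rep_mul_apply, hc, hd, map_add, map_add, map_smul, map_smul, hc, hd,
      rep_radical cs hker, rep_radical cs hker]
    module
  · have hfin := finite_projected_roots (cs := cs) hirr hpos hy hker j
    have : Finite {x | ∃ β, IsRoot cs β ∧ x = β - (β j / y j) • y} := hfin
    let F : W → B → {x | ∃ β, IsRoot cs β ∧ x = β - (β j / y j) • y} := fun g i =>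
      ⟨rep cs g (α i) - (rep cs g (α i) j / y j) • y, _, (isRoot_α i).rep g, rfl⟩
    have hF : ∀ g h, F g = F h → g⁻¹ * h ∈ A := fun g h hgh => by
      have h1 : ∀ i, ∃ c : ℝ, rep cs (g⁻¹ * h) (α i) = α i + c • y := fun i => by
        have h2 : rep cs g (α i) - (rep cs g (α i) j / y j) • y =
          rep cs h (α i) - (rep cs h (α i) j / y j) • y := congrArg Subtype.val (congrFun hgh i)
        refine ⟨rep cs h (α i) j / y j - rep cs g (α i) j / y j, ?_⟩
        have h3 : rep cs h (α i) = rep cs g (α i) +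
            (rep cs h (α i) j / y j - rep cs g (α i) j / y j) • y := by
          rw [sub_smul, add_sub_assoc', add_sub_right_comm, h2]
          abel
        rw [rep_mul_apply]
        conv_lhs => rw [h3]
        rw [map_add, map_smul, rep_radical cs hker, rep_inv_rep]
      choose c hc using h1
      intro x
      refine ⟨∑ i, x i * c i, ?_⟩
      conv_lhs => rw [eq_sum_smul_α x]
      simp only [map_sum, map_smul, hc, smul_add, Finset.sum_add_distrib, smul_smul]
      rw [← eq_sum_smul_α, Finset.sum_smul]
    have : Finite (W ⧸ A) := by
      refine Finite.of_injective (fun q : W ⧸ A => F q.out) fun p q hpq => ?_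
      have := QuotientGroup.eq.mpr (hF _ _ hpq)
      simpa using this
    exact Subgroup.finiteIndex_of_finite_quotient

end Affine

section Euler

variable [Fintype B] [DecidableEq B]

/-- The (nonsymmetric) Euler form of a Coxeter element, with the data used to study its powers. -/
structure EulerData (cs : CoxeterSystem M W) (w : W) where
  /-- the position of a generator in the word -/
  ord : B → ℕ
  ord_inj : Function.Injective ord
  /-- the Euler form -/
  E : (B → ℝ) →ₗ[ℝ] (B → ℝ) →ₗ[ℝ] ℝ
  E_apply : ∀ x y, E x y = ∑ b, ∑ c,
    (if b = c then 1 else if ord b < ord c then entry M b c else 0) * x b * y c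
  form_eq : ∀ x y, form M x y = E x y + E y x
  E_rep : ∀ x y, E y (rep cs w x) = -E x y
  recurrence : ∀ x b, rep cs w x b + x b = ∑ c,
    if ord c < ord b then -entry M b c * x c
    else if ord b < ord c then -entry M b c * rep cs w x c else 0
  /-- the roots dual to the coordinates -/
  p : B → B → ℝ
  p_root : ∀ b, IsRoot cs (p b)
  E_p : ∀ x b, E x (p b) = x b

theorem rep_wordProd_apply_of_notMem (cs : CoxeterSystem M W) (l : List B) (x : B → ℝ) {b : B}
    (hb : b ∉ l) : rep cs (cs.wordProd l) x b = x b := by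
  induction l with
  | nil => simp
  | cons i l ih =>
    rw [List.mem_cons, not_or] at hb
    rw [cs.wordProd_cons, rep_mul_apply, rep_simple_apply_of_ne cs hb.1, ih hb.2]

theorem rep_wordProd_append_cons (cs : CoxeterSystem M W) (l₁ l₂ : List B) (b : B)
    (hl : (l₁ ++ b :: l₂).Nodup) (x : B → ℝ) :
    rep cs (cs.wordProd (l₁ ++ b :: l₂)) x b + x b =
      ∑ c, if c = b then 0 else -entry M b c *
        (if c ∈ l₂ then rep cs (cs.wordProd (l₁ ++ b :: l₂)) x c else x c) := by
  have hl' := List.nodup_append.mp hl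
  have hb1 : b ∉ l₁ := fun h => hl'.2.2 b h b (by simp) rfl
  have hb2 : b ∉ l₂ := (List.nodup_cons.mp hl'.2.1).1
  set z := rep cs (cs.wordProd l₂) x with hz
  have hzb : z b = x b := rep_wordProd_apply_of_notMem cs l₂ x hb2
  have e : ∀ c, c ∉ l₁ → rep cs (cs.wordProd (l₁ ++ b :: l₂)) x c =
      rep cs (cs.simple b) z c := fun c hc => by
    rw [cs.wordProd_append, rep_mul_apply, rep_wordProd_apply_of_notMem cs l₁ _ hc,
      cs.wordProd_cons, rep_mul_apply]
  have e2 : ∀ c, c ≠ b → (if c ∈ l₂ then rep cs (cs.wordProd (l₁ ++ b :: l₂)) x c else x c) =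
      z c := fun c hc => by
    split_ifs with h
    · rw [e c fun h1 => hl'.2.2 c h1 c (by simp [h]) rfl, rep_simple_apply_of_ne cs hc]
    · exact (rep_wordProd_apply_of_notMem cs l₂ x h).symm
  have e3 : ∀ c, (if c = b then 0 else -entry M b c *
        (if c ∈ l₂ then rep cs (cs.wordProd (l₁ ++ b :: l₂)) x c else x c)) =
      (if c = b then 2 * z b else 0) - entry M b c * z c := fun c => by
    by_cases hc : c = b
    · subst hc; simp [entry_self]
    · rw [if_neg hc, if_neg hc, e2 c hc]; ring
  simp only [e3, Finset.sum_sub_distrib, Finset.sum_ite_eq', Finset.mem_univ, if_true]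
  rw [e b hb1, rep_simple_apply, ← form_α_left, ← hzb]
  simp [α]
  ring

theorem idxOf_lt_iff {l₁ l₂ : List B} {c d : B} (hl : (l₁ ++ c :: l₂).Nodup)
    (hd : d ∈ l₁ ++ c :: l₂) :
    (l₁ ++ c :: l₂).idxOf c < (l₁ ++ c :: l₂).idxOf d ↔ d ∈ l₂ := by
  have hl' := List.nodup_append.mp hl
  have hc1 : c ∉ l₁ := fun h => hl'.2.2 c h c (by simp) rfl
  have hc2 : c ∉ l₂ := (List.nodup_cons.mp hl'.2.1).1
  rw [List.idxOf_append_of_notMem hc1, List.idxOf_cons_self]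
  by_cases h1 : d ∈ l₁
  · rw [List.idxOf_append_of_mem h1]
    have := List.idxOf_lt_length_iff.mpr h1
    have h2 : d ∉ l₂ := fun h => hl'.2.2 d h1 d (by simp [h]) rfl
    constructor
    · intro h; omega
    · intro h; exact absurd h h2
  · rw [List.idxOf_append_of_notMem h1]
    by_cases h2 : d = c
    · subst h2
      simp [hc2]
    · rw [List.idxOf_cons_ne _ (Ne.symm h2)]
      constructor
      · intro _
        simpa [h1, h2] using hd
      · intro _; omega

theorem exists_eulerData (cs : CoxeterSystem M W) (l : List B) (hl : l.Nodup)
    (hall : ∀ b, b ∈ l) : Nonempty (EulerData cs (cs.wordProd l)) := by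
  have hord : Function.Injective l.idxOf := fun b c h => (List.idxOf_inj (hall b)).mp h
  set U : B → B → ℝ := fun b c =>
    if b = c then 1 else if l.idxOf b < l.idxOf c then entry M b c else 0 with hU
  set E : (B → ℝ) →ₗ[ℝ] (B → ℝ) →ₗ[ℝ] ℝ := Matrix.toLinearMap₂' ℝ (Matrix.of U) with hE
  have E_apply : ∀ x y, E x y = ∑ b, ∑ c, U b c * x b * y c := fun x y => by
    simp only [hE, Matrix.toLinearMap₂'_apply, Matrix.of_apply, smul_eq_mul]
    exact Finset.sum_congr rfl fun i _ => Finset.sum_congr rfl fun j _ => by ring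
  have hUU : ∀ b c, entry M b c = U b c + U c b := fun b c => by
    rcases eq_or_ne b c with rfl | hbc
    · simp [hU, entry_self]; norm_num
    · have : l.idxOf b ≠ l.idxOf c := fun h => hbc (hord h)
      rcases lt_or_gt_of_ne this with h | h
      · simp [hU, hbc, hbc.symm, h, h.le.not_gt]
      · simp [hU, hbc, hbc.symm, h, h.le.not_gt, entry_comm b c]
  have form_eq : ∀ x y, form M x y = E x y + E y x := fun x y => by
    rw [form_apply, E_apply, E_apply, Finset.sum_comm (f := fun b c => U b c * y b * x c),
      ← Finset.sum_add_distrib]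
    refine Finset.sum_congr rfl fun b _ => ?_
    rw [← Finset.sum_add_distrib]
    refine Finset.sum_congr rfl fun c _ => ?_
    rw [hUU]; ring
  have recurrence : ∀ x b, rep cs (cs.wordProd l) x b + x b = ∑ c,
      if l.idxOf c < l.idxOf b then -entry M b c * x c
      else if l.idxOf b < l.idxOf c then -entry M b c * rep cs (cs.wordProd l) x c else 0 := by
    intro x b
    obtain ⟨l₁, l₂, rfl⟩ := List.append_of_mem (hall b)
    rw [rep_wordProd_append_cons cs l₁ l₂ b hl]
    refine Finset.sum_congr rfl fun c _ => ?_
    rcases eq_or_ne c b with rfl | hcb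
    · simp
    · rw [if_neg hcb]
      have h1 := idxOf_lt_iff hl (hall c)
      have hne : (l₁ ++ b :: l₂).idxOf c ≠ (l₁ ++ b :: l₂).idxOf b := fun h => hcb (hord h)
      by_cases h : c ∈ l₂
      · have h2 := h1.mpr h
        rw [if_pos h, if_neg h2.le.not_gt, if_pos h2]
      · have h2 : ¬ _ := fun h' => h (h1.mp h')
        rw [if_neg h, if_pos (by omega)]
  have E_rep : ∀ x y, E y (rep cs (cs.wordProd l) x) = -E x y := fun x y => by
    rw [E_apply, E_apply, Finset.sum_comm (f := fun b c => U b c * x b * y c),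
      ← Finset.sum_neg_distrib]
    refine Finset.sum_congr rfl fun b _ => ?_
    have h : ∑ c, (U b c * rep cs (cs.wordProd l) x c + U c b * x c) = 0 := by
      have h1 := recurrence x b
      have h2 : ∀ c, U b c * rep cs (cs.wordProd l) x c + U c b * x c =
          (if c = b then rep cs (cs.wordProd l) x b + x b else 0) -
          (if l.idxOf c < l.idxOf b then -entry M b c * x c
          else if l.idxOf b < l.idxOf c then -entry M b c * rep cs (cs.wordProd l) x c
          else 0) := fun c => by
        rcases eq_or_ne c b with rfl | hcb
        · simp [hU]
        · have : l.idxOf b ≠ l.idxOf c := fun h => hcb (hord h.symm)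
          rcases lt_or_gt_of_ne this with h | h
          · simp [hU, hcb, hcb.symm, h, h.le.not_gt]
          · simp [hU, hcb, hcb.symm, h, h.le.not_gt, entry_comm b c]
      simp only [h2, Finset.sum_sub_distrib, Finset.sum_ite_eq', Finset.mem_univ, if_true]
      rw [h1, sub_self]
    rw [Finset.sum_add_distrib] at h
    have e1 : ∑ c, U b c * y b * rep cs (cs.wordProd l) x c =
        y b * ∑ c, U b c * rep cs (cs.wordProd l) x c := by
      rw [Finset.mul_sum]; exact Finset.sum_congr rfl fun c _ => by ring
    have e2 : ∑ c, U c b * x c * y b = y b * ∑ c, U c b * x c := by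
      rw [Finset.mul_sum]; exact Finset.sum_congr rfl fun c _ => by ring
    rw [e1, e2]
    linear_combination y b * h
  have hp : ∀ b, ∃ p, IsRoot cs p ∧ ∀ x, E x p = x b := fun b => by
    obtain ⟨l₁, l₂, hll⟩ := List.append_of_mem (hall b)
    have hl0 := hl
    rw [hll] at hl0
    have hl' := List.nodup_append.mp hl0
    have hb1 : b ∉ l₁ := fun h => hl'.2.2 b h b (by simp) rfl
    have hb2 : b ∉ l₂ := (List.nodup_cons.mp hl'.2.1).1
    set p := rep cs (cs.wordProd l₁) (α b) with hp
    have hpc : ∀ c, c ∉ l₁ → p c = (α b : B → ℝ) c :=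
      fun c hc => rep_wordProd_apply_of_notMem cs l₁ _ hc
    refine ⟨p, (isRoot_α b).rep _, fun x => ?_⟩
    have hUp : ∀ c, ∑ d, U c d * p d = (α b : B → ℝ) c := fun c => by
      by_cases hc : c ∈ l₁
      · obtain ⟨m₁, m₂, hm⟩ := List.append_of_mem hc
        have hlm : l = m₁ ++ c :: (m₂ ++ b :: l₂) := by rw [hll, hm]; simp
        have hn1 : (m₁ ++ c :: m₂).Nodup := hm ▸ hl'.1
        have hrec := rep_wordProd_append_cons cs m₁ m₂ c hn1 (α b)
        rw [← hm, ← hp] at hrec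
        have hcb : c ≠ b := by rintro rfl; exact hb1 hc
        have hcb0 : (α b : B → ℝ) c = 0 := by simp [α, hcb]
        have h2 : ∀ d, U c d * p d = (if d = c then p c else 0) - (if d = c then 0 else
            -entry M c d * (if d ∈ m₂ then p d else (α b : B → ℝ) d)) := fun d => by
          rcases eq_or_ne d c with rfl | hdc
          · simp [hU]
          · have h3 : l.idxOf c < l.idxOf d ↔ d ∈ m₂ ++ b :: l₂ := by
              have h4 : d ∈ m₁ ++ c :: (m₂ ++ b :: l₂) := hlm ▸ hall d
              rw [hlm] at hl ⊢
              exact idxOf_lt_iff hl h4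
            rw [if_neg hdc, if_neg hdc]
            by_cases h5 : d ∈ m₂ ++ b :: l₂
            · rw [hU]
              simp only [hdc.symm, if_false, h3.mpr h5, if_true]
              by_cases h6 : d ∈ m₂
              · rw [if_pos h6]; ring
              · rw [if_neg h6]
                have h7 : d ∉ l₁ := fun h => by
                  rcases List.mem_append.mp h5 with h8 | h8
                  · exact h6 h8
                  · exact hl'.2.2 d h d h8 rfl
                rw [hpc d h7]; ring
            · have h6 : ¬ _ := fun h => h5 (h3.mp h)
              have h7 : d ∉ m₂ := fun h => h5 (by simp [h])
              have h8 : d ≠ b := by rintro rfl; exact h5 (by simp)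
              rw [hU]
              simp [hdc.symm, h6, h7, α, h8]
        simp only [h2, Finset.sum_sub_distrib, Finset.sum_ite_eq', Finset.mem_univ, if_true]
        rw [← hrec, hcb0]; ring
      · rw [Finset.sum_eq_single c]
        · rw [hpc c hc]; simp [hU]
        · intro d _ hdc
          by_cases h3 : l.idxOf c < l.idxOf d
          · have h4 : d ∈ l₂ := by
              have hc' : c ∈ b :: l₂ := by
                have := hall c; rw [hll] at this
                exact (List.mem_append.mp this).resolve_left hc
              obtain ⟨m₁, m₂, hm⟩ := List.append_of_mem hc'
              have hlm : l = (l₁ ++ m₁) ++ c :: m₂ := by rw [hll, hm]; simp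
              have h5 : d ∈ m₂ := by
                have h4 : d ∈ (l₁ ++ m₁) ++ c :: m₂ := hlm ▸ hall d
                rw [hlm] at hl h3
                exact (idxOf_lt_iff hl h4).mp h3
              cases m₁ with
              | nil =>
                rw [List.nil_append, List.cons.injEq] at hm
                rw [hm.2]; exact h5
              | cons e m =>
                rw [List.cons_append, List.cons.injEq] at hm
                rw [hm.2]; simp [h5]
            have h5 : d ∉ l₁ := fun h => hl'.2.2 d h d (by simp [h4]) rfl
            have h6 : d ≠ b := by rintro rfl; exact hb2 h4
            rw [hpc d h5]; simp [α, h6]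
          · simp [hU, hdc.symm, h3]
        · simp
    rw [E_apply]
    have : ∀ c, ∑ d, U c d * x c * p d = x c * (α b : B → ℝ) c := fun c => by
      rw [← hUp, Finset.mul_sum]
      exact Finset.sum_congr rfl fun d _ => by ring
    simp only [this]
    simp [α, Pi.single_apply]
  choose p p_root E_p using hp
  exact ⟨⟨l.idxOf, hord, E, E_apply, form_eq, E_rep, recurrence, p, p_root, fun x b => E_p b x⟩⟩

end Euler

section Dynamics

open Filter Topology

variable [Fintype B] [DecidableEq B] {cs : CoxeterSystem M W} {w : W}

theorem rep_zpow_add_apply (cs : CoxeterSystem M W) (w : W) (k l : ℤ) (x : B → ℝ) :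
    rep cs (w ^ (k + l)) x = rep cs (w ^ k) (rep cs (w ^ l) x) := by
  rw [zpow_add, rep_mul_apply]

theorem rep_zpow_succ_apply (cs : CoxeterSystem M W) (w : W) (k : ℤ) (x : B → ℝ) :
    rep cs (w ^ (k + 1)) x = rep cs w (rep cs (w ^ k) x) := by
  rw [add_comm, rep_zpow_add_apply, zpow_one]

namespace EulerData

variable (D : EulerData cs w)
include D

theorem term_nonneg {x : B → ℝ} (hx : 0 ≤ x) (hwx : 0 ≤ rep cs w x) (b c : B) :
    0 ≤ if D.ord c < D.ord b then -entry M b c * x c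
      else if D.ord b < D.ord c then -entry M b c * rep cs w x c else 0 := by
  split_ifs with h1 h2
  · exact mul_nonneg (neg_nonneg.mpr (entry_nonpos fun h => by simp [h] at h1)) (hx c)
  · exact mul_nonneg (neg_nonneg.mpr (entry_nonpos fun h => by simp [h] at h2)) (hwx c)
  · exact le_rfl

theorem term_le {x : B → ℝ} (hx : 0 ≤ x) (hwx : 0 ≤ rep cs w x) (b c : B) :
    (if D.ord c < D.ord b then -entry M b c * x c
      else if D.ord b < D.ord c then -entry M b c * rep cs w x c else 0) ≤
      rep cs w x b + x b := by
  rw [D.recurrence]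
  exact Finset.single_le_sum (f := fun c => if D.ord c < D.ord b then -entry M b c * x c
      else if D.ord b < D.ord c then -entry M b c * rep cs w x c else 0)
    (fun c _ => D.term_nonneg hx hwx b c) (Finset.mem_univ c)

theorem ord_lt_or_gt {b c : B} (h : b ≠ c) : D.ord b < D.ord c ∨ D.ord c < D.ord b :=
  lt_or_gt_of_ne fun h' => h (D.ord_inj h')

theorem eq_zero_of_coord (hirr : cs.IsIrreducibleSystem) {x : B → ℝ} {N : ℤ}
    (hx : ∀ k ≥ N, 0 ≤ rep cs (w ^ k) x) {j : B} {N' : ℤ}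
    (hj : ∀ k ≥ N', rep cs (w ^ k) x j = 0) : x = 0 := by
  have key : ∀ i, ∃ N' : ℤ, ∀ k ≥ N', rep cs (w ^ k) x i = 0 := by
    refine forall_of_adjacent hirr (fun i => ∃ N' : ℤ, ∀ k ≥ N', rep cs (w ^ k) x i = 0)
      ⟨N', hj⟩ ?_
    rintro i b ⟨n, hn⟩ hib
    rw [entry_comm] at hib
    by_cases hbi : b = i
    · subst hbi; exact ⟨n, hn⟩
    have hlt : 0 < -entry M b i :=
      neg_pos.mpr (lt_of_le_of_ne (entry_nonpos hbi) hib)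
    have h1 : ∀ k ≥ max n N, (if D.ord i < D.ord b then -entry M b i * rep cs (w ^ k) x i
        else if D.ord b < D.ord i then -entry M b i * rep cs (w ^ (k + 1)) x i else 0) ≤ 0 := by
      intro k hk
      have hk1 : n ≤ k := le_trans (le_max_left _ _) hk
      have hk2 : N ≤ k := le_trans (le_max_right _ _) hk
      have h := D.term_le (hx k hk2) (by rw [← rep_zpow_succ_apply]; exact hx _ (by omega)) b i
      rw [← rep_zpow_succ_apply, hn k hk1, hn (k + 1) (by omega), add_zero] at h
      exact h
    refine ⟨max n N + 1, fun k hk => ?_⟩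
    have hk2 : N ≤ k := by have := le_max_right n N; omega
    refine le_antisymm ?_ (hx k hk2 i)
    rcases D.ord_lt_or_gt hbi with h | h
    · have := h1 (k - 1) (by omega)
      rw [if_neg h.not_gt, if_pos h, sub_add_cancel] at this
      exact nonpos_of_mul_nonpos_right this hlt
    · have := h1 k (by omega)
      rw [if_pos h] at this
      exact nonpos_of_mul_nonpos_right this hlt
  choose n hn using key
  have : ∃ m, ∀ i, n i ≤ m := by
    obtain ⟨m, hm⟩ := (Set.finite_range n).bddAbove
    exact ⟨m, fun i => hm ⟨i, rfl⟩⟩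
  obtain ⟨m, hm⟩ := this
  apply rep_injective cs (w ^ m)
  rw [map_zero]
  exact funext fun i => hn i m (hm i)

theorem form_eq_zero_of_fixed {y : B → ℝ} (hy : rep cs w y = y) (x : B → ℝ) :
    form M x y = 0 := by
  have := D.E_rep y x
  rw [hy] at this
  rw [D.form_eq, this]; ring

theorem not_fixed (hirr : cs.IsIrreducibleSystem)
    (hnon : ¬ ∃ A : Subgroup W, (∀ x ∈ A, ∀ y ∈ A, Commute x y) ∧ A.FiniteIndex)
    {y : B → ℝ} (hy0 : 0 ≤ y) (hy : y ≠ 0) : rep cs w y ≠ y := fun h =>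
  hnon (virtually_abelian hirr hy0 hy (D.form_eq_zero_of_fixed h))

theorem coord_bounded (hirr : cs.IsIrreducibleSystem) {v : B → ℝ}
    (hv : ∀ g, 0 ≤ rep cs g v) {j : B} {R : ℝ} (hj : ∀ k : ℤ, rep cs (w ^ k) v j ≤ R) :
    ∃ R, ∀ (k : ℤ) i, rep cs (w ^ k) v i ≤ R := by
  have key : ∀ i, ∃ R, ∀ k : ℤ, rep cs (w ^ k) v i ≤ R := by
    refine forall_of_adjacent hirr (fun i => ∃ R, ∀ k : ℤ, rep cs (w ^ k) v i ≤ R) ⟨R, hj⟩ ?_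
    rintro i b ⟨R, hR⟩ hib
    rw [entry_comm] at hib
    by_cases hbi : b = i
    · subst hbi; exact ⟨R, hR⟩
    have hlt : 0 < -entry M b i :=
      neg_pos.mpr (lt_of_le_of_ne (entry_nonpos hbi) hib)
    refine ⟨(R + R) / -entry M b i, fun k => ?_⟩
    rw [le_div_iff₀ hlt, mul_comm]
    have h1 : ∀ k : ℤ, (if D.ord i < D.ord b then -entry M b i * rep cs (w ^ k) v i
        else if D.ord b < D.ord i then -entry M b i * rep cs (w ^ (k + 1)) v i else 0) ≤ R + R := by
      intro k
      have h := D.term_le (hv (w ^ k)) (by rw [← rep_zpow_succ_apply]; exact hv _) b i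
      rw [← rep_zpow_succ_apply] at h
      exact h.trans (add_le_add (hR _) (hR _))
    rcases D.ord_lt_or_gt hbi with h | h
    · have := h1 (k - 1)
      rwa [if_neg h.not_gt, if_pos h, sub_add_cancel] at this
    · have := h1 k
      rwa [if_pos h] at this
  choose R hR using key
  obtain ⟨m, hm⟩ := (Set.finite_range R).bddAbove
  exact ⟨m, fun k i => (hR i k).trans (hm ⟨i, rfl⟩)⟩

theorem coord_not_const (hirr : cs.IsIrreducibleSystem)
    (hnon : ¬ ∃ A : Subgroup W, (∀ x ∈ A, ∀ y ∈ A, Commute x y) ∧ A.FiniteIndex)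
    {v : B → ℝ} (hv0 : v ≠ 0) (hv : ∀ g, 0 ≤ rep cs g v) (j : B) (c : ℝ)
    (hj : ∀ k : ℤ, rep cs (w ^ k) v j = c) : False := by
  by_cases hc : c = 0
  · subst hc
    exact hv0 (D.eq_zero_of_coord hirr (N := 0) (fun k _ => hv _) (N' := 0) fun k _ => hj k)
  obtain ⟨R, hR⟩ := D.coord_bounded hirr hv (j := j) (R := c) fun k => (hj k).le
  let u : ℕ → B → ℝ := fun n => ((n : ℝ) + 1)⁻¹ • ∑ k ∈ Finset.range (n + 1), rep cs (w ^ (k : ℤ)) v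
  have hu : ∀ n, u n ∈ Set.Icc (0 : B → ℝ) (fun _ => R) := by
    intro n
    have hn : (0 : ℝ) < (n : ℝ) + 1 := by positivity
    refine ⟨smul_nonneg (by positivity) (Finset.sum_nonneg fun k _ => hv _), fun i => ?_⟩
    simp only [u, Pi.smul_apply, Finset.sum_apply, smul_eq_mul]
    rw [inv_mul_le_iff₀ hn]
    calc ∑ k ∈ Finset.range (n + 1), rep cs (w ^ (k : ℤ)) v i
        ≤ ∑ k ∈ Finset.range (n + 1), R := Finset.sum_le_sum fun k _ => hR _ _
      _ = _ := by simp
  obtain ⟨y, hy, φ, hφ, hlim⟩ := isCompact_Icc.tendsto_subseq hu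
  have hyj : y j = c := by
    have h1 : Tendsto (fun n => u (φ n) j) atTop (𝓝 (y j)) := tendsto_pi_nhds.mp hlim j
    have h2 : ∀ n, u n j = c := fun n => by
      have hn : (0 : ℝ) < (n : ℝ) + 1 := by positivity
      simp only [u, Pi.smul_apply, Finset.sum_apply, smul_eq_mul, hj]
      rw [inv_mul_eq_iff_eq_mul₀ hn.ne']
      simp
    simp only [h2] at h1
    exact tendsto_nhds_unique h1 tendsto_const_nhds
  have hwy : rep cs w y = y := by
    have h1 : Tendsto (fun n => rep cs w (u (φ n))) atTop (𝓝 (rep cs w y)) :=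
      ((continuous_rep w).tendsto y).comp hlim
    have h2 := h1.sub hlim
    have h3 : ∀ n, rep cs w (u n) - u n = ((n : ℝ) + 1)⁻¹ •
        (rep cs (w ^ ((n + 1 : ℕ) : ℤ)) v - v) := fun n => by
      simp only [u]
      rw [map_smul, ← smul_sub, map_sum]
      simp only [← rep_zpow_succ_apply]
      congr 1
      rw [← Finset.sum_sub_distrib]
      have := Finset.sum_range_sub (fun k : ℕ => rep cs (w ^ (k : ℤ)) v) (n + 1)
      simpa using this
    have h4 : Tendsto (fun n => rep cs w (u n) - u n) atTop (𝓝 0) := by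
      rw [tendsto_pi_nhds]
      intro i
      have h5 : Tendsto (fun n : ℕ => ((n : ℝ) + 1)⁻¹ * R) atTop (𝓝 (0 * R)) :=
        (tendsto_inv_atTop_zero.comp
          (tendsto_natCast_atTop_atTop.atTop_add tendsto_const_nhds)).mul_const R
      rw [zero_mul] at h5
      refine squeeze_zero_norm (fun n => ?_) h5
      rw [h3]
      have h6 := hv (w ^ ((n + 1 : ℕ) : ℤ)) i
      have h7 := hR ((n + 1 : ℕ) : ℤ) i
      have h8 := hv 1 i
      have h9 := hR 0 i
      simp only [rep_one_apply, zpow_zero, Pi.zero_apply] at h6 h8 h9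
      rw [Pi.smul_apply, Pi.sub_apply, smul_eq_mul, norm_mul, Real.norm_of_nonneg (by positivity)]
      refine mul_le_mul_of_nonneg_left ?_ (by positivity)
      rw [Real.norm_eq_abs, abs_le]
      constructor <;> linarith
    exact sub_eq_zero.mp (tendsto_nhds_unique h2 (h4.comp hφ.tendsto_atTop))
  exact D.not_fixed hirr hnon hy.1 (fun h => hc (by rw [← hyj, h]; rfl)) hwy

theorem coord_not_periodic (hirr : cs.IsIrreducibleSystem)
    (hnon : ¬ ∃ A : Subgroup W, (∀ x ∈ A, ∀ y ∈ A, Commute x y) ∧ A.FiniteIndex)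
    {v : B → ℝ} (hv0 : v ≠ 0) (hv : ∀ g, 0 ≤ rep cs g v) (j : B) {d : ℕ} (hd : 0 < d)
    (hj : ∀ k : ℤ, rep cs (w ^ (k + d)) v j = rep cs (w ^ k) v j) : False := by
  set u : B → ℝ := ∑ k ∈ Finset.range d, rep cs (w ^ (k : ℤ)) v with hu
  have hu' : ∀ m : ℤ, rep cs (w ^ m) u j =
      ∑ k ∈ Finset.range d, rep cs (w ^ (m + (k : ℤ))) v j := fun m => by
    rw [hu, map_sum, Finset.sum_apply]
    simp only [rep_zpow_add_apply]
  have hstep : ∀ m : ℤ, rep cs (w ^ (m + 1)) u j = rep cs (w ^ m) u j := fun m => by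
    rw [hu', hu']
    have h1 := Finset.sum_range_succ (fun k : ℕ => rep cs (w ^ (m + (k : ℤ))) v j) d
    have h2 := Finset.sum_range_succ' (fun k : ℕ => rep cs (w ^ (m + (k : ℤ))) v j) d
    rw [h1, hj] at h2
    have h3 : ∀ k : ℕ, m + ((k + 1 : ℕ) : ℤ) = m + 1 + k := fun k => by push_cast; ring
    simp only [h3] at h2
    simpa using h2.symm
  refine D.coord_not_const hirr hnon (v := u) ?_ (fun g => ?_) j (rep cs (w ^ (0 : ℤ)) u j)
    fun k => ?_
  · intro h0
    apply hv0
    funext i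
    have h1 : rep cs (w ^ ((0 : ℕ) : ℤ)) v i ≤ u i := by
      rw [hu, Finset.sum_apply]
      exact Finset.single_le_sum (f := fun k : ℕ => rep cs (w ^ (k : ℤ)) v i)
        (fun k _ => hv _ i) (Finset.mem_range.mpr hd)
    have h2 := hv 1 i
    rw [h0] at h1
    simp at h1 h2
    exact le_antisymm h1 h2
  · rw [hu, map_sum]
    refine Finset.sum_nonneg fun k _ => ?_
    rw [← rep_mul_apply]; exact hv _
  · induction k using Int.induction_on with
    | zero => rfl
    | succ k ih => rw [hstep, ih]
    | pred k ih => rw [← ih, ← hstep, sub_add_cancel]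

theorem E_rep_rep (x y : B → ℝ) : D.E (rep cs w x) (rep cs w y) = D.E x y := by
  rw [D.E_rep, D.E_rep, neg_neg]

theorem E_zpow (k : ℤ) (x y : B → ℝ) :
    D.E (rep cs (w ^ k) x) (rep cs (w ^ k) y) = D.E x y := by
  induction k using Int.induction_on with
  | zero => simp
  | succ k ih => rw [rep_zpow_succ_apply, rep_zpow_succ_apply, E_rep_rep, ih]
  | pred k ih =>
    rw [← D.E_rep_rep, ← rep_zpow_succ_apply, ← rep_zpow_succ_apply, sub_add_cancel, ih]

theorem coord_zpow (k : ℤ) (x : B → ℝ) (j : B) :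
    rep cs (w ^ k) x j = D.E x (rep cs (w ^ (-k)) (D.p j)) := by
  rw [← D.E_p (rep cs (w ^ k) x) j, ← D.E_zpow (-k), ← rep_zpow_add_apply]
  simp

theorem form_p (j : B) (x : B → ℝ) : form M (D.p j) x = x j - rep cs w⁻¹ x j := by
  have h := D.E_rep (rep cs w⁻¹ x) (D.p j)
  rw [rep_rep_inv, D.E_p] at h
  rw [D.form_eq, h, D.E_p]; ring

theorem coord_p (k : ℤ) (i j : B) :
    rep cs (w ^ k) (D.p i) j = -rep cs (w ^ (-k - 1)) (D.p j) i := by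
  have h := D.E_rep (rep cs (w ^ (-k - 1)) (D.p j)) (D.p i)
  rw [← rep_zpow_succ_apply, sub_add_cancel, D.E_p] at h
  rw [D.coord_zpow, h]

theorem zpow_p_injective (hirr : cs.IsIrreducibleSystem) [Infinite W]
    (hnon : ¬ ∃ A : Subgroup W, (∀ x ∈ A, ∀ y ∈ A, Commute x y) ∧ A.FiniteIndex) (j : B) :
    Function.Injective fun k : ℤ => rep cs (w ^ k) (D.p j) := by
  have key : ∀ a b : ℤ, a < b → rep cs (w ^ a) (D.p j) ≠ rep cs (w ^ b) (D.p j) := by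
    intro a b hab h
    obtain ⟨v, hv0, hv⟩ := exists_limit_vector cs
    obtain ⟨d, rfl⟩ := Int.le.dest hab.le
    refine D.coord_not_periodic hirr hnon hv0 hv j (d := d) (by omega) fun k => ?_
    rw [D.coord_zpow, D.coord_zpow]
    congr 1
    have h1 := congrArg (rep cs (w ^ (-k - (a + d)))) h
    rw [← rep_zpow_add_apply, ← rep_zpow_add_apply] at h1
    rw [show -(k + (d : ℤ)) = -k - (a + d) + a by ring, h1, sub_add_cancel]
  intro a b h
  by_contra hab
  rcases lt_or_gt_of_ne hab with h' | h'
  · exact key a b h' h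
  · exact key b a h' h.symm

end EulerData

theorem exists_sign_agree {β : ℤ → B → ℝ} (hβ : ∀ n, IsRoot cs (β n))
    (hinj : Function.Injective β) (g : W) :
    ∃ m : ℕ, ∀ n : ℤ, (m : ℤ) ≤ |n| → (0 ≤ rep cs g (β n) ↔ 0 ≤ β n) := by
  have hfin : {n | ¬ (0 ≤ rep cs g (β n) ↔ 0 ≤ β n)}.Finite := by
    refine ((((finite_invSet cs g⁻¹).union ((finite_invSet cs g⁻¹).image Neg.neg))).preimage
      hinj.injOn).subset fun n hn => ?_
    have hn : ¬ (0 ≤ rep cs g (β n) ↔ 0 ≤ β n) := hn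
    by_cases h : 0 ≤ β n
    · left
      refine ⟨hβ n, h, ?_⟩
      rw [inv_inv]
      exact ((hβ n).rep g).not_nonneg_iff.mp fun h' => hn (iff_of_true h' h)
    · right
      refine ⟨-β n, ⟨(hβ n).neg, neg_nonneg.mpr ((hβ n).not_nonneg_iff.mp h), ?_⟩, neg_neg _⟩
      rw [inv_inv, map_neg, neg_nonpos]
      by_contra h'
      exact hn (iff_of_false h' h)
  obtain ⟨m, hm⟩ := (hfin.image Int.natAbs).bddAbove
  refine ⟨m + 1, fun n hn => ?_⟩
  by_contra h
  have := hm ⟨n, h, rfl⟩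
  rw [Int.abs_eq_natAbs] at hn
  omega

end Dynamics

section Orientation

open Filter Topology

variable [Fintype B] [DecidableEq B] {cs : CoxeterSystem M W} {w : W}

namespace EulerData

variable (D : EulerData cs w)
include D

theorem eventually_nonpos_neg (hirr : cs.IsIrreducibleSystem) [Infinite W]
    (hnon : ¬ ∃ A : Subgroup W, (∀ x ∈ A, ∀ y ∈ A, Commute x y) ∧ A.FiniteIndex)
    {ε : ℝ} (hε : ε = 1 ∨ ε = -1) {i : B} {m : ℤ}
    (hi : ∀ n ≥ m, 0 ≤ ε • rep cs (w ^ n) (D.p i)) (j : B) :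
    ∃ m : ℤ, ∀ n ≤ m, ε • rep cs (w ^ n) (D.p j) ≤ 0 := by
  obtain ⟨m', hm'⟩ := exists_sign_agree (fun n => (D.p_root j).rep (w ^ n))
    (D.zpow_p_injective hirr hnon j) w
  have hstep : ∀ n : ℤ, n ≤ -(m' : ℤ) → (0 ≤ rep cs (w ^ (n + 1)) (D.p j) ↔
      0 ≤ rep cs (w ^ n) (D.p j)) := fun n hn => by
    rw [rep_zpow_succ_apply]
    exact hm' n (le_abs.mpr (Or.inr (by omega)))
  have hroot : ∀ n : ℤ, IsRoot cs (rep cs (w ^ n) (D.p j)) := fun n => (D.p_root j).rep _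
  have hconst : ∀ k : ℕ, (0 ≤ rep cs (w ^ (-(m' : ℤ) - k)) (D.p j) ↔
      0 ≤ rep cs (w ^ (-(m' : ℤ))) (D.p j)) := fun k => by
    induction k with
    | zero => simp
    | succ k ih =>
      rw [← ih, ← hstep _ (by omega)]
      congr! 4
      push_cast; ring
  have hconst' : ∀ n : ℤ, n ≤ -(m' : ℤ) → (0 ≤ rep cs (w ^ n) (D.p j) ↔
      0 ≤ rep cs (w ^ (-(m' : ℤ))) (D.p j)) := fun n hn => by
    obtain ⟨k, hk⟩ := Int.le.dest hn
    rw [← hconst k]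
    congr! 4
    omega
  have hno : ¬ ∀ n ≤ -(m' : ℤ), 0 ≤ ε • rep cs (w ^ n) (D.p j) := by
    intro hneg
    have h0 : ε • D.p i = 0 := by
      refine D.eq_zero_of_coord hirr (N := m) (fun k hk => ?_) (j := j)
        (N' := max m m') fun k hk => ?_
      · rw [map_smul]; exact hi k hk
      · have hk1 : m ≤ k := (le_max_left _ _).trans hk
        have hk2 : (m' : ℤ) ≤ k := (le_max_right _ _).trans hk
        rw [map_smul]
        refine le_antisymm ?_ (hi k hk1 j)
        rw [Pi.smul_apply, D.coord_p, smul_neg, neg_nonpos]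
        exact hneg _ (by omega) i
    have : ε ≠ 0 := by rcases hε with h | h <;> rw [h] <;> norm_num
    exact (D.p_root i).ne_zero ((smul_eq_zero.mp h0).resolve_left this)
  refine ⟨-(m' : ℤ), fun n hn => ?_⟩
  by_cases hp : 0 ≤ rep cs (w ^ (-(m' : ℤ))) (D.p j)
  · rcases hε with rfl | rfl
    · exact absurd (fun n hn => by rw [one_smul]; exact (hconst' n hn).mpr hp) hno
    · rw [neg_one_smul, neg_nonpos]
      exact (hconst' n hn).mpr hp
  · rcases hε with rfl | rfl
    · rw [one_smul, ← (hroot n).not_nonneg_iff, hconst' n hn]; exact hp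
    · refine absurd (fun n hn => ?_) hno
      rw [neg_one_smul, neg_nonneg, ← (hroot n).not_nonneg_iff, hconst' n hn]; exact hp

theorem exists_orientation (hirr : cs.IsIrreducibleSystem) [Infinite W]
    (hnon : ¬ ∃ A : Subgroup W, (∀ x ∈ A, ∀ y ∈ A, Commute x y) ∧ A.FiniteIndex) :
    ∃ ε : ℝ, (ε = 1 ∨ ε = -1) ∧ ∀ (j : B) (g : W),
      (∃ m : ℤ, ∀ n ≥ m, 0 ≤ rep cs g (rep cs (w ^ n) (ε • D.p j))) ∧
      (∃ m : ℤ, ∀ n ≤ m, rep cs g (rep cs (w ^ n) (ε • D.p j)) ≤ 0) := by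
  have hroot : ∀ j, ∀ n : ℤ, IsRoot cs (rep cs (w ^ n) (D.p j)) := fun j n => (D.p_root j).rep _
  have hstab : ∀ j, ∃ m' : ℕ, ∀ n : ℤ, (m' : ℤ) ≤ n → (0 ≤ rep cs (w ^ n) (D.p j) ↔
      0 ≤ rep cs (w ^ (m' : ℤ)) (D.p j)) := fun j => by
    obtain ⟨m', hm'⟩ := exists_sign_agree (hroot j) (D.zpow_p_injective hirr hnon j) w
    refine ⟨m', fun n hn => ?_⟩
    obtain ⟨k, rfl⟩ := Int.le.dest hn
    clear hn
    induction k with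
    | zero => simp
    | succ k ih =>
      rw [← ih, ← hm' (m' + k) (le_abs.mpr (Or.inl (by omega))), ← rep_zpow_succ_apply]
      congr! 4
  have hpos : ∀ j, ∃ ε : ℝ, (ε = 1 ∨ ε = -1) ∧ ∃ m : ℤ, ∀ n ≥ m,
      0 ≤ ε • rep cs (w ^ n) (D.p j) := fun j => by
    obtain ⟨m', hm'⟩ := hstab j
    by_cases h : 0 ≤ rep cs (w ^ (m' : ℤ)) (D.p j)
    · exact ⟨1, Or.inl rfl, m', fun n hn => by rw [one_smul]; exact (hm' n hn).mpr h⟩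
    · refine ⟨-1, Or.inr rfl, m', fun n hn => ?_⟩
      rw [neg_one_smul, neg_nonneg, ← (hroot j n).not_nonneg_iff, hm' n hn]; exact h
  obtain ⟨v, hv0, -⟩ := exists_limit_vector cs
  obtain ⟨i, -⟩ : ∃ i, v i ≠ 0 := by
    by_contra h; push Not at h; exact hv0 (funext h)
  obtain ⟨ε, hε, m, hm⟩ := hpos i
  have hneg : ∀ j, ∃ m : ℤ, ∀ n ≤ m, ε • rep cs (w ^ n) (D.p j) ≤ 0 :=
    D.eventually_nonpos_neg hirr hnon hε hm
  have hposj : ∀ j, ∃ m : ℤ, ∀ n ≥ m, 0 ≤ ε • rep cs (w ^ n) (D.p j) := by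
    intro j
    obtain ⟨ε', hε', m', hm'⟩ := hpos j
    by_cases h : ε' = ε
    · subst h; exact ⟨m', hm'⟩
    exfalso
    have h' : ε' = -ε := by
      rcases hε with rfl | rfl <;> rcases hε' with rfl | rfl <;> simp_all
    obtain ⟨m₁, hm₁⟩ := hneg j
    obtain ⟨m₂, hm₂⟩ := D.eventually_nonpos_neg hirr hnon hε' hm' j
    have h1 := hm₁ (min m₁ m₂) (min_le_left _ _)
    have h2 := hm₂ (min m₁ m₂) (min_le_right _ _)
    rw [h', neg_smul, neg_nonpos] at h2
    have h3 := le_antisymm h1 h2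
    have : ε ≠ 0 := by rcases hε with h | h <;> rw [h] <;> norm_num
    exact (hroot j _).ne_zero ((smul_eq_zero.mp h3).resolve_left this)
  refine ⟨ε, hε, fun j g => ?_⟩
  have hroot' : ∀ n : ℤ, IsRoot cs (rep cs (w ^ n) (ε • D.p j)) := fun n => by
    rcases hε with rfl | rfl
    · rw [one_smul]; exact hroot j n
    · rw [neg_one_smul, map_neg]; exact (hroot j n).neg
  have hinj : Function.Injective fun n : ℤ => rep cs (w ^ n) (ε • D.p j) := by
    intro a b hab
    apply D.zpow_p_injective hirr hnon j
    simp only [map_smul] at hab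
    have : ε ≠ 0 := by rcases hε with h | h <;> rw [h] <;> norm_num
    exact smul_right_injective _ this hab
  obtain ⟨m₀, hm₀⟩ := exists_sign_agree hroot' hinj g
  obtain ⟨m₁, hm₁⟩ := hposj j
  obtain ⟨m₂, hm₂⟩ := hneg j
  constructor
  · refine ⟨max m₀ m₁, fun n hn => (hm₀ n (le_abs.mpr (Or.inl ?_))).mpr ?_⟩
    · exact (le_max_left _ _).trans hn
    · rw [map_smul]; exact hm₁ n ((le_max_right _ _).trans hn)
  · refine ⟨min (-m₀) m₂, fun n hn => ?_⟩
    have h1 : n ≤ -m₀ := hn.trans (min_le_left _ _)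
    rw [← ((hroot' n).rep g).not_nonneg_iff, hm₀ n (le_abs.mpr (Or.inr (by omega))),
      (hroot' n).not_nonneg_iff, map_smul]
    exact hm₂ n (hn.trans (min_le_right _ _))

end EulerData

end Orientation

section Nesting

open Filter Topology

variable [Fintype B] [DecidableEq B] {cs : CoxeterSystem M W} {w : W}

/-- The roots dual to the coordinates, all oriented towards the attracting end of `w`. -/
structure OrientedRoots (cs : CoxeterSystem M W) (w : W) where
  /-- the oriented roots -/
  P : B → B → ℝ
  /-- the common sign -/
  ε : ℝ
  ε_mul_self : ε * ε = 1
  root : ∀ j, IsRoot cs (P j)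
  pos : ∀ (j : B) (g : W), ∃ m : ℤ, ∀ n ≥ m, 0 ≤ rep cs g (rep cs (w ^ n) (P j))
  neg : ∀ (j : B) (g : W), ∃ m : ℤ, ∀ n ≤ m, rep cs g (rep cs (w ^ n) (P j)) ≤ 0
  form_P : ∀ (j : B) (x : B → ℝ), form M (P j) x = ε * (x j - rep cs w⁻¹ x j)

theorem EulerData.exists_orientedRoots (D : EulerData cs w) (hirr : cs.IsIrreducibleSystem)
    [Infinite W]
    (hnon : ¬ ∃ A : Subgroup W, (∀ x ∈ A, ∀ y ∈ A, Commute x y) ∧ A.FiniteIndex) :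
    Nonempty (OrientedRoots cs w) := by
  obtain ⟨ε, hε, h⟩ := D.exists_orientation hirr hnon
  refine ⟨⟨fun j => ε • D.p j, ε, ?_, fun j => ?_, fun j g => (h j g).1, fun j g => (h j g).2,
    fun j x => ?_⟩⟩
  · rcases hε with rfl | rfl <;> norm_num
  · rcases hε with rfl | rfl
    · rw [one_smul]; exact D.p_root j
    · rw [neg_one_smul]; exact (D.p_root j).neg
  · rw [map_smul, LinearMap.smul_apply, D.form_p, smul_eq_mul]

namespace OrientedRoots

variable (O : OrientedRoots cs w)
include O

theorem neg_two_lt (j j' : B) (k k' : ℤ) :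
    -2 < form M (rep cs (w ^ k) (O.P j)) (rep cs (w ^ k') (O.P j')) := by
  by_contra h
  obtain ⟨m₁, h₁⟩ := O.pos j 1
  obtain ⟨m₂, h₂⟩ := O.pos j' 1
  obtain ⟨n₁, h₃⟩ := O.neg j 1
  obtain ⟨n₂, h₄⟩ := O.neg j' 1
  simp only [rep_one_apply] at h₁ h₂ h₃ h₄
  refine not_nonpos_of_form_le ((O.root j).rep _) ((O.root j').rep _) (not_lt.mp h)
    (g := w ^ (max (m₁ - k) (m₂ - k'))) (h := w ^ (min (n₁ - k) (n₂ - k'))) ?_ ?_ ?_ ?_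
  all_goals rw [← rep_zpow_add_apply]
  · exact h₁ _ (by have := le_max_left (m₁ - k) (m₂ - k'); omega)
  · exact h₂ _ (by have := le_max_right (m₁ - k) (m₂ - k'); omega)
  · exact h₃ _ (by have := min_le_left (n₁ - k) (n₂ - k'); omega)
  · exact h₄ _ (by have := min_le_right (n₁ - k) (n₂ - k'); omega)

theorem zpow_injective (j : B) : Function.Injective fun k : ℤ => rep cs (w ^ k) (O.P j) := by
  have key : ∀ a b : ℤ, a < b → rep cs (w ^ a) (O.P j) ≠ rep cs (w ^ b) (O.P j) := by
    intro a b hab h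
    have hper : ∀ n : ℤ, rep cs (w ^ n) (O.P j) = rep cs (w ^ (n + (b - a))) (O.P j) := by
      intro n
      have := congrArg (rep cs (w ^ (n - a))) h
      rw [← rep_zpow_add_apply, ← rep_zpow_add_apply, sub_add_cancel] at this
      rw [this]; congr 3; ring
    have hper' : ∀ (k : ℕ) (n : ℤ),
        rep cs (w ^ n) (O.P j) = rep cs (w ^ (n + k * (b - a))) (O.P j) := by
      intro k
      induction k with
      | zero => intro n; simp
      | succ k ih =>
        intro n
        rw [ih, hper]; congr 3; push_cast; ring
    obtain ⟨m, hm⟩ := O.pos j 1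
    obtain ⟨m', hm'⟩ := O.neg j 1
    simp only [rep_one_apply] at hm hm'
    refine ((O.root j).rep (w ^ m')).ne_zero (le_antisymm (hm' m' le_rfl) ?_)
    rw [hper' (m - m').natAbs]
    refine hm _ ?_
    have h1 : m - m' ≤ ((m - m').natAbs : ℤ) := Int.le_natAbs
    have h2 : (1 : ℤ) ≤ b - a := by omega
    nlinarith
  intro a b h
  by_contra hab
  rcases lt_or_gt_of_ne hab with h' | h'
  · exact key a b h' h
  · exact key b a h' h.symm

/-- The negative halfspace of `w ^ q • P i` is contained in that of `P j`. -/
def Nested (_O : OrientedRoots cs w) (i j : B) (q : ℤ) : Prop :=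
  ∀ g, rep cs g (rep cs (w ^ q) (_O.P i)) ≤ 0 → rep cs g (_O.P j) ≤ 0

theorem nested_trans {i j k : B} {q q' : ℤ} (h : O.Nested i j q) (h' : O.Nested j k q') :
    O.Nested i k (q + q') := by
  intro g hg
  refine h' g ?_
  rw [← rep_mul_apply]
  apply h
  rw [rep_mul_apply, ← rep_zpow_add_apply, add_comm]
  exact hg

theorem nested_of_form (i j : B) : ∃ Q : ℤ, ∀ q ≥ Q,
    2 ≤ form M (O.P j) (rep cs (w ^ q) (O.P i)) → O.Nested i j q := by
  obtain ⟨m, hm⟩ := O.neg j 1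
  obtain ⟨m', hm'⟩ := O.pos i 1
  simp only [rep_one_apply] at hm hm'
  refine ⟨m' - m, fun q hq hform g hg => ?_⟩
  by_contra hcon
  refine not_nonpos_of_form_le (O.root j) ((O.root i).rep (w ^ q)).neg
    (by rw [map_neg]; linarith) (g := g) (h := w ^ m) ?_ ?_ (hm m le_rfl) ?_
  · exact ((O.root j).rep g).not_nonpos_iff.mp hcon
  · rw [map_neg]; exact neg_nonneg.mpr hg
  · rw [map_neg, ← rep_zpow_add_apply]; exact neg_nonpos.mpr (hm' _ (by omega))

theorem exists_pos_pos (D : EulerData cs w) {y : B → ℝ} (hy : ∀ k : ℤ, 0 ≤ rep cs (w ^ k) y)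
    (hy0 : y ≠ 0) (hyy : form M y y = 0) :
    ∃ j, 0 < y j ∧ 0 < rep cs (w ^ (-1 : ℤ)) y j := by
  set x := rep cs (w ^ (-1 : ℤ)) y with hx
  have hwx : rep cs w x = y := by rw [hx, ← rep_zpow_succ_apply]; simp
  have hx0 : 0 ≤ x := hy (-1)
  have hyn : 0 ≤ y := by simpa using hy 0
  by_contra hcon
  push Not at hcon
  have hzero : ∀ j, x j * y j = 0 := fun j => by
    by_cases h : 0 < y j
    · have := le_antisymm (hcon j h) (hx0 j)
      rw [this, zero_mul]
    · rw [le_antisymm (not_lt.mp h) (hyn j)]; simp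
  have hE : D.E x y = 0 := by
    have h1 := D.E_rep x y
    have h2 := D.form_eq y y
    rw [hwx] at h1
    linarith
  rw [D.E_apply] at hE
  have hterm : ∀ b c, (if b = c then 1 else if D.ord b < D.ord c then entry M b c else 0) *
      x b * y c ≤ 0 := by
    intro b c
    split_ifs with h1 h2
    · subst h1; rw [one_mul, hzero]
    · have := mul_nonneg (hx0 b) (hyn c)
      rw [mul_assoc]
      exact mul_nonpos_of_nonpos_of_nonneg (entry_nonpos h1) this
    · simp
  have hterm0 : ∀ b c, D.ord b < D.ord c → entry M b c * x b * y c = 0 := by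
    intro b c hbc
    have h1 := (Finset.sum_eq_zero_iff_of_nonpos (fun b _ =>
      Finset.sum_nonpos fun c _ => hterm b c)).mp hE b (Finset.mem_univ b)
    have h2 := (Finset.sum_eq_zero_iff_of_nonpos (fun c _ => hterm b c)).mp h1 c
      (Finset.mem_univ c)
    rwa [if_neg (fun h => by simp [h] at hbc), if_pos hbc] at h2
  obtain ⟨j₀, hj₀⟩ : ∃ j, y j ≠ 0 := by
    by_contra h; push Not at h; exact hy0 (funext h)
  obtain ⟨j, hj, hmax⟩ := Finset.exists_max_image (Finset.univ.filter fun j => y j ≠ 0) D.ord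
    ⟨j₀, by simpa using hj₀⟩
  simp only [Finset.mem_filter, Finset.mem_univ, true_and] at hj hmax
  have hrec := D.recurrence x j
  rw [hwx] at hrec
  have h0 : (y j + x j) * y j = 0 := by
    rw [hrec, Finset.sum_mul]
    refine Finset.sum_eq_zero fun c _ => ?_
    split_ifs with h1 h2
    · have := hterm0 c j h1
      rw [entry_comm] at this
      rw [neg_mul, neg_mul, this, neg_zero]
    · have : y c = 0 := by
        by_contra h
        exact absurd (hmax c h) (by omega)
      rw [this]; simp
    · simp
  rw [add_mul, hzero, add_zero] at h0
  exact hj (mul_self_eq_zero.mp h0)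

theorem exists_nested (D : EulerData cs w) (hirr : cs.IsIrreducibleSystem)
    (hnon : ¬ ∃ A : Subgroup W, (∀ x ∈ A, ∀ y ∈ A, Commute x y) ∧ A.FiniteIndex) (i : B) :
    (∃ j, ∀ Q : ℤ, ∃ q ≥ Q, O.Nested i j q ∧ O.Nested i j (q + 1)) ∧
    ∀ j, ∀ Q : ℤ, ∃ q ≥ Q, O.Nested i j q := by
  obtain ⟨m, hm⟩ := O.pos i 1
  simp only [rep_one_apply] at hm
  set β : ℕ → B → ℝ := fun n => rep cs (w ^ (m + n)) (O.P i) with hβ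
  have hroot : ∀ n, IsRoot cs (β n) := fun n => (O.root i).rep _
  have hpos : ∀ n, 0 ≤ β n := fun n => hm _ (by omega)
  have hinj : Function.Injective β := fun a b h => by
    have := O.zpow_injective i h
    omega
  obtain ⟨v, φ, hφ, hv0, hlim, hnorm, hv⟩ :=
    exists_limit hroot hpos (tendsto_norm_of_injective hroot hpos hinj)
  have hlimk : ∀ (k : ℤ), Tendsto (fun n => ‖β (φ n)‖⁻¹ • rep cs (w ^ k) (β (φ n))) atTop
      (𝓝 (rep cs (w ^ k) v)) := fun k => by
    simp only [← map_smul]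
    exact ((continuous_rep (w ^ k)).tendsto v).comp hlim
  have hlimf : ∀ (j : B) (k : ℤ), Tendsto (fun n => ‖β (φ n)‖⁻¹ *
      form M (O.P j) (rep cs (w ^ k) (β (φ n)))) atTop (𝓝 (form M (O.P j) (rep cs (w ^ k) v))) :=
    fun j k => by
      have := tendsto_form (M := M) (tendsto_const_nhds (x := O.P j)) (hlimk k)
      simpa only [map_smul, smul_eq_mul] using this
  have hinv : Tendsto (fun n => ‖β (φ n)‖⁻¹) atTop (𝓝 0) := tendsto_inv_atTop_zero.comp hnorm
  set y : B → ℝ := O.ε • (rep cs w v - v) with hy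
  have hycoord : ∀ (k : ℤ) j, rep cs (w ^ k) y j = form M (O.P j) (rep cs (w ^ (k + 1)) v) := by
    intro k j
    rw [O.form_P, hy, map_smul, map_sub, Pi.smul_apply, Pi.sub_apply, smul_eq_mul,
      ← zpow_neg_one, ← rep_zpow_add_apply]
    have h1 : rep cs w v = rep cs (w ^ (1 : ℤ)) v := by rw [zpow_one]
    rw [h1, ← rep_zpow_add_apply]
    congr 4
    ring_nf
  have hynn : ∀ k : ℤ, 0 ≤ rep cs (w ^ k) y := by
    intro k j
    rw [hycoord]
    have h1 : Tendsto (fun n => ‖β (φ n)‖⁻¹ * -2) atTop (𝓝 (0 * -2)) := hinv.mul_const _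
    rw [zero_mul] at h1
    refine le_of_tendsto_of_tendsto' h1 (hlimf j (k + 1)) fun n => ?_
    refine mul_le_mul_of_nonneg_left ?_ (by positivity)
    have := O.neg_two_lt j i 0 ((k + 1) + (m + φ n))
    simp only [zpow_zero, rep_one_apply] at this
    rw [← rep_zpow_add_apply]
    exact this.le
  have hε0 : O.ε ≠ 0 := fun h => by have := O.ε_mul_self; simp [h] at this
  have hvn : 0 ≤ v := by simpa using hv 1
  have hy0 : y ≠ 0 := by
    intro h
    refine D.not_fixed hirr hnon hvn hv0 (sub_eq_zero.mp ?_)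
    exact (smul_eq_zero.mp h).resolve_left hε0
  have hlimvv : ∀ k : ℤ, form M v (rep cs (w ^ k) v) = 0 := by
    intro k
    have h1 := tendsto_form (M := M) hlim (hlimk k)
    have h2 : ∀ n, form M (‖β (φ n)‖⁻¹ • β (φ n)) (‖β (φ n)‖⁻¹ • rep cs (w ^ k) (β (φ n))) =
        ‖β (φ n)‖⁻¹ * (‖β (φ n)‖⁻¹ * form M (O.P i) (rep cs (w ^ k) (O.P i))) := by
      intro n
      have h3 : rep cs (w ^ k) (β (φ n)) =
          rep cs (w ^ (m + φ n : ℤ)) (rep cs (w ^ k) (O.P i)) := by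
        rw [hβ, ← rep_zpow_add_apply, ← rep_zpow_add_apply, add_comm k]
      rw [h3]
      simp only [map_smul, LinearMap.smul_apply, smul_eq_mul]
      rw [show form M (β (φ n)) = form M (rep cs (w ^ (m + φ n : ℤ)) (O.P i)) from rfl,
        form_rep_rep]
    simp only [h2] at h1
    have h3 := hinv.mul (hinv.mul_const (form M (O.P i) (rep cs (w ^ k) (O.P i))))
    rw [zero_mul] at h3
    exact tendsto_nhds_unique h1 h3
  have hyy : form M y y = 0 := by
    have h0 := hlimvv 0
    have h1 := hlimvv 1
    simp only [zpow_zero, zpow_one, rep_one_apply] at h0 h1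
    simp only [hy, map_smul, map_sub, LinearMap.smul_apply, LinearMap.sub_apply, smul_eq_mul,
      form_rep_rep, h0, h1, form_comm (rep cs w v) v]
    ring
  have hlarge : ∀ (j : B) (k : ℤ), 0 < form M (O.P j) (rep cs (w ^ k) v) →
      ∀ᶠ n in atTop, O.Nested i j (k + (m + φ n)) := by
    intro j k hk
    obtain ⟨Q, hQ⟩ := O.nested_of_form i j
    have h1 := (hnorm.atTop_mul_pos hk (hlimf j k)).eventually_ge_atTop 2
    have h2 : ∀ᶠ n in atTop, Q - k - m ≤ (φ n : ℤ) :=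
      (tendsto_natCast_atTop_atTop.comp hφ.tendsto_atTop).eventually_ge_atTop _
    filter_upwards [h1, h2] with n hn hn2
    refine hQ _ (by omega) ?_
    rw [rep_zpow_add_apply]
    rwa [← mul_assoc, mul_inv_cancel₀ (norm_ne_zero_iff.mpr (hroot _).ne_zero), one_mul] at hn
  have hbig : ∀ (k Q : ℤ), ∀ᶠ n in atTop, Q ≤ k + (m + φ n) := by
    intro k Q
    have h2 : ∀ᶠ n in atTop, Q - k - m ≤ (φ n : ℤ) :=
      (tendsto_natCast_atTop_atTop.comp hφ.tendsto_atTop).eventually_ge_atTop _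
    filter_upwards [h2] with n hn
    omega
  constructor
  · obtain ⟨j, hj1, hj2⟩ := O.exists_pos_pos D hynn hy0 hyy
    refine ⟨j, fun Q => ?_⟩
    have e1 := hycoord 0 j
    simp only [zpow_zero, rep_one_apply] at e1
    rw [e1] at hj1
    rw [hycoord] at hj2
    obtain ⟨n, hn1, hn2, hn3⟩ := ((hlarge j _ hj1).and ((hlarge j _ hj2).and
      (hbig (-1 + 1) Q))).exists
    refine ⟨_, hn3, hn2, ?_⟩
    convert hn1 using 1
    ring
  · intro j Q
    obtain ⟨k, hk⟩ : ∃ k : ℤ, 0 < rep cs (w ^ k) y j := by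
      by_contra h
      push Not at h
      exact hy0 (D.eq_zero_of_coord hirr (N := 0) (fun k _ => hynn k) (N' := 0) fun k _ =>
        le_antisymm (h k) (hynn k j))
    rw [hycoord] at hk
    obtain ⟨n, hn1, hn2⟩ := ((hlarge j _ hk).and (hbig (k + 1) Q)).exists
    exact ⟨_, hn2, hn1⟩

theorem nested_of_large (D : EulerData cs w) (hirr : cs.IsIrreducibleSystem)
    (hnon : ¬ ∃ A : Subgroup W, (∀ x ∈ A, ∀ y ∈ A, Commute x y) ∧ A.FiniteIndex) (i : B) :
    ∃ N : ℕ, ∀ q : ℕ, N ≤ q → O.Nested i i q := by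
  obtain ⟨j, hj⟩ := (O.exists_nested D hirr hnon i).1
  obtain ⟨r, hr, hri⟩ := (O.exists_nested D hirr hnon j).2 i 0
  obtain ⟨q, hq, hq1, hq2⟩ := hj 1
  have h1 := O.nested_trans hq1 hri
  have h2 := O.nested_trans hq2 hri
  obtain ⟨c, hc⟩ := Int.eq_ofNat_of_zero_le (show 0 ≤ q + r by omega)
  have hc2 : q + 1 + r = ((c + 1 : ℕ) : ℤ) := by push_cast; omega
  rw [hc] at h1
  rw [hc2] at h2
  have hmul : ∀ (s : ℕ), O.Nested i i s → ∀ a : ℕ, O.Nested i i ((a * s : ℕ) : ℤ) := by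
    intro s hs a
    induction a with
    | zero => intro g hg; simpa using hg
    | succ a ih =>
      have := O.nested_trans ih hs
      convert this using 1
      push_cast; ring
  have hcpos : 0 < c := by omega
  refine ⟨c * c, fun n hn => ?_⟩
  have hr' := Nat.mod_lt n hcpos
  have hk : c ≤ n / c := (Nat.le_div_iff_mul_le hcpos).mpr hn
  have hd := Nat.div_add_mod n c
  have := O.nested_trans (hmul c h1 (n / c - n % c)) (hmul (c + 1) h2 (n % c))
  convert this using 1
  rw [← Nat.cast_add]
  congr 1
  obtain ⟨d, hd'⟩ := Nat.exists_eq_add_of_le (hr'.le.trans hk)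
  rw [hd'] at hd ⊢
  rw [Nat.add_sub_cancel_left]
  nlinarith

theorem finite_transverse (D : EulerData cs w) (hirr : cs.IsIrreducibleSystem)
    (hnon : ¬ ∃ A : Subgroup W, (∀ x ∈ A, ∀ y ∈ A, Commute x y) ∧ A.FiniteIndex) (i : B) :
    ∃ K : ℕ, {t | IsRoot cs t ∧ 0 ≤ t ∧
      ∀ k : ℤ, |k| ≤ K → |form M t (rep cs (w ^ k) (O.P i))| < 2}.Finite := by
  by_contra hcon
  push Not at hcon
  have hex : ∀ K : ℕ, ∃ t, (IsRoot cs t ∧ 0 ≤ t ∧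
      ∀ k : ℤ, |k| ≤ K → |form M t (rep cs (w ^ k) (O.P i))| < 2) ∧ (K : ℝ) ≤ ‖t‖ := by
    intro K
    by_contra h
    push Not at h
    exact hcon K ((finite_pos_roots_norm_le cs K).subset fun t ht =>
      ⟨ht.1, ht.2.1, (h t ht).le⟩)
  choose β hβ hβn using hex
  obtain ⟨v, φ, hφ, hv0, hlim, hnorm, hv⟩ := exists_limit (fun n => (hβ n).1)
    (fun n => (hβ n).2.1) (tendsto_atTop_mono hβn tendsto_natCast_atTop_atTop)
  have hzero : ∀ k : ℤ, form M v (rep cs (w ^ k) (O.P i)) = 0 := by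
    intro k
    have h1 := tendsto_form (M := M) hlim (tendsto_const_nhds (x := rep cs (w ^ k) (O.P i)))
    simp only [map_smul, LinearMap.smul_apply, smul_eq_mul] at h1
    have hinv : Tendsto (fun n => ‖β (φ n)‖⁻¹ * 2) atTop (𝓝 (0 * 2)) :=
      (tendsto_inv_atTop_zero.comp hnorm).mul_const 2
    rw [zero_mul] at hinv
    refine tendsto_nhds_unique h1 (squeeze_zero_norm' ?_ hinv)
    have h2 : ∀ᶠ n in atTop, |k| ≤ (φ n : ℤ) :=
      (tendsto_natCast_atTop_atTop.comp hφ.tendsto_atTop).eventually_ge_atTop _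
    filter_upwards [h2] with n hn
    rw [norm_mul, norm_inv, norm_norm, Real.norm_eq_abs]
    exact mul_le_mul_of_nonneg_left ((hβ _).2.2 k hn).le (by positivity)
  have hε0 : O.ε ≠ 0 := fun h => by have := O.ε_mul_self; simp [h] at this
  have hstep : ∀ k : ℤ, rep cs (w ^ (k + 1)) v i = rep cs (w ^ k) v i := by
    intro k
    have h1 := hzero (-(k + 1))
    rw [form_comm, form_rep_left, zpow_neg, inv_inv, O.form_P, ← zpow_neg_one,
      ← rep_zpow_add_apply] at h1
    have h2 := (mul_eq_zero.mp h1).resolve_left hε0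
    rw [sub_eq_zero] at h2
    rw [h2, neg_add_cancel_comm_assoc]
  refine D.coord_not_const hirr hnon hv0 hv i (rep cs (w ^ (0 : ℤ)) v i) fun k => ?_
  induction k using Int.induction_on with
  | zero => rfl
  | succ k ih => rw [hstep, ih]
  | pred k ih => rw [← ih, ← hstep, sub_add_cancel]

end OrientedRoots

end Nesting

section Axis

variable {X : Type*} [MetricSpace X] [MulAction W X]

theorem exists_min_displacement [ProperSpace X] [Nonempty X]
    (hiso : ∀ w : W, Isometry (fun p : X => w • p)) [ProperlyDiscontinuousSMul W X]
    (hcocompact : ∃ K : Set X, IsCompact K ∧ ⋃ w : W, (fun p : X => w • p) '' K = Set.univ)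
    (w : W) : ∃ x : X, ∀ y : X, dist x (w • x) ≤ dist y (w • y) := by
  obtain ⟨K, hK, hcov⟩ := hcocompact
  have hmem : ∀ x : X, ∃ (g : W) (k : X), k ∈ K ∧ x = g • k := fun x => by
    have : x ∈ ⋃ w : W, (fun p : X => w • p) '' K := by rw [hcov]; trivial
    obtain ⟨g, k, hk, rfl⟩ := Set.mem_iUnion.mp this
    exact ⟨g, k, hk, rfl⟩
  have hdisp : ∀ (g : W) (k : X), dist (g • k) (w • g • k) = dist k ((g⁻¹ * w * g) • k) := by
    intro g k
    rw [← (hiso g).dist_eq k]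
    simp only [← mul_smul]
    congr 2
    group
  obtain ⟨x₀⟩ := ‹Nonempty X›
  set R := dist x₀ (w • x₀) with hR
  have hfin := ProperlyDiscontinuousSMul.finite_disjoint_inter_image (Γ := W) hK
    (hK.cthickening (r := R))
  set C : Set W := {u | ∃ g, u = g⁻¹ * w * g ∧ ∃ k ∈ K, dist k (u • k) ≤ R} with hC
  have hCfin : C.Finite := by
    refine hfin.subset ?_
    rintro u ⟨-, -, k, hk, hle⟩
    refine ⟨u • k, ⟨k, hk, rfl⟩, ?_⟩
    exact Metric.mem_cthickening_of_dist_le _ k _ _ hk (by rwa [dist_comm])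
  obtain ⟨g₁, k₁, hk₁, hx₁⟩ := hmem x₀
  have hmin : ∀ u : W, ∃ k ∈ K, ∀ k' ∈ K, dist k (u • k) ≤ dist k' (u • k') := fun u =>
    hK.exists_isMinOn ⟨k₁, hk₁⟩ (continuous_id.dist (hiso u).continuous).continuousOn
  choose κ hκ hκmin using hmin
  have hCne : (g₁⁻¹ * w * g₁) ∈ C :=
    ⟨g₁, rfl, k₁, hk₁, by rw [← hdisp, ← hx₁]⟩
  obtain ⟨u, hu, humin⟩ := Set.exists_min_image C (fun u => dist (κ u) (u • κ u)) hCfin ⟨_, hCne⟩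
  obtain ⟨g, rfl, -⟩ := hu
  have hle : ∀ y : X, dist y (w • y) ≤ R →
      dist (g • κ (g⁻¹ * w * g)) (w • g • κ (g⁻¹ * w * g)) ≤ dist y (w • y) := by
    intro y hy
    obtain ⟨g', k, hk, rfl⟩ := hmem y
    rw [hdisp] at hy ⊢
    rw [hdisp]
    exact (humin _ ⟨g', rfl, k, hk, hy⟩).trans (hκmin _ k hk)
  refine ⟨g • κ (g⁻¹ * w * g), fun y => ?_⟩
  by_cases hy : dist y (w • y) ≤ R
  · exact hle y hy
  · exact (hle x₀ le_rfl).trans (not_le.mp hy).le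

theorem smul_ne_of_infinite_order [ProperlyDiscontinuousSMul W X] {w : W}
    (hw : Function.Injective fun n : ℤ => w ^ n) (x : X) : w • x ≠ x := by
  intro h
  have hfin := ProperlyDiscontinuousSMul.finite_disjoint_inter_image (Γ := W)
    (isCompact_singleton (x := x)) (isCompact_singleton (x := x))
  have hpow : ∀ n : ℕ, w ^ n • x = x := fun n => by
    induction n with
    | zero => simp
    | succ n ih => rw [pow_succ, mul_smul, h, ih]
  refine Set.infinite_range_of_injective (f := fun n : ℕ => w ^ n) (fun a b hab => ?_)
    (hfin.subset ?_)
  · have : w ^ (a : ℤ) = w ^ (b : ℤ) := by rw [zpow_natCast, zpow_natCast]; exact hab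
    exact_mod_cast hw this
  · rintro _ ⟨n, rfl⟩
    exact ⟨x, ⟨x, rfl, hpow n⟩, rfl⟩

theorem dist_chain (hCN : SatisfiesCN X) {p : ℕ → X} {δ : ℝ}
    (h1 : ∀ n, dist (p n) (p (n + 1)) = δ) (h2 : ∀ n, dist (p n) (p (n + 2)) = 2 * δ) (n : ℕ) :
    dist (p 0) (p n) = n * δ := by
  induction n using Nat.strong_induction_on with
  | _ n ih =>
  match n with
  | 0 => simp
  | 1 => simp [h1]
  | n + 2 =>
    have e1 := ih n (by omega)
    have e2 := ih (n + 1) (by omega)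
    have hcn := hCN (p 0) (p n) (p (n + 2)) (p (n + 1)) (by rw [h1, h2]; ring)
      (by rw [h1, h2]; ring)
    rw [e1, e2, h2] at hcn
    refine le_antisymm ?_ ?_
    · have := dist_triangle (p 0) (p (n + 1)) (p (n + 2))
      rw [e2, h1] at this
      push_cast at this ⊢
      linarith
    · refine abs_le_of_sq_le_sq' ?_ dist_nonneg |>.2
      push_cast at hcn ⊢
      nlinarith

theorem dist_zpow_smul (hiso : ∀ w : W, Isometry (fun p : X => w • p)) (hCN : SatisfiesCN X)
    (hgeo : IsGeodesicSpace X) {w : W} {x : X} (hx : ∀ y : X, dist x (w • x) ≤ dist y (w • y))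
    (n : ℕ) : dist x (w ^ n • x) = n * dist x (w • x) := by
  obtain ⟨σ, hσ0, hσ1, hσ⟩ := hgeo x (w • x)
  set L := dist x (w • x) with hL
  have hL0 : 0 ≤ L := dist_nonneg
  have hxm : dist x (σ (L / 2)) = L / 2 := by
    rw [← hσ0, hσ 0 ⟨le_rfl, hL0⟩ (L / 2) ⟨by linarith, by linarith⟩, abs_of_nonpos (by linarith)]
    ring
  have hmx : dist (σ (L / 2)) (w • x) = L / 2 := by
    rw [← hσ1, hσ (L / 2) ⟨by linarith, by linarith⟩ L ⟨hL0, le_rfl⟩, abs_of_nonpos (by linarith)]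
    ring
  set m := σ (L / 2) with hm
  have hmm : dist m (w • m) = L := by
    refine le_antisymm ?_ (hx m)
    have := dist_triangle m (w • x) (w • m)
    rw [(hiso w).dist_eq x m, hxm, hmx] at this
    linarith
  set p : ℕ → X := fun n => w ^ (n / 2) • if n % 2 = 0 then x else m with hp
  have hpe : ∀ i, p (2 * i) = w ^ i • x := fun i => by simp [hp]
  have hpo : ∀ i, p (2 * i + 1) = w ^ i • m := fun i => by
    have : (2 * i + 1) / 2 = i := by omega
    simp [hp, this]
  have h1 : ∀ n, dist (p n) (p (n + 1)) = L / 2 := by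
    intro n
    obtain ⟨i, rfl | rfl⟩ := Nat.even_or_odd' n
    · rw [hpe, hpo, (hiso _).dist_eq, hxm]
    · rw [hpo, show 2 * i + 1 + 1 = 2 * (i + 1) by ring, hpe, pow_succ, mul_smul,
        (hiso _).dist_eq, hmx]
  have h2 : ∀ n, dist (p n) (p (n + 2)) = 2 * (L / 2) := by
    intro n
    obtain ⟨i, rfl | rfl⟩ := Nat.even_or_odd' n
    · rw [hpe, show 2 * i + 2 = 2 * (i + 1) by ring, hpe, pow_succ, mul_smul,
        (hiso _).dist_eq, ← hL]
      ring
    · rw [hpo, show 2 * i + 1 + 2 = 2 * (i + 1) + 1 by ring, hpo, pow_succ, mul_smul,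
        (hiso _).dist_eq, hmm]
      ring
  have := dist_chain hCN h1 h2 (2 * n)
  rw [hpe, show p 0 = x by simp [hp]] at this
  rw [this]
  push_cast
  ring

theorem exists_axis [ProperSpace X] [Nonempty X] (hgeo : IsGeodesicSpace X)
    (hCN : SatisfiesCN X) (hiso : ∀ w : W, Isometry (fun p : X => w • p))
    [ProperlyDiscontinuousSMul W X]
    (hcocompact : ∃ K : Set X, IsCompact K ∧ ⋃ w : W, (fun p : X => w • p) '' K = Set.univ)
    {w : W} (hw : Function.Injective fun n : ℤ => w ^ n) :
    ∃ (γ : ℝ → X) (L : ℝ), IsAxisOf w γ L := by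
  obtain ⟨x, hx⟩ := exists_min_displacement hiso hcocompact w
  have hdist := dist_zpow_smul hiso hCN hgeo hx
  have hL : 0 < dist x (w • x) := dist_pos.mpr (smul_ne_of_infinite_order hw x).symm
  obtain ⟨σ, hσ0, hσ1, hσ⟩ := hgeo x (w • x)
  set L := dist x (w • x) with hLdef
  have hdistz : ∀ k l : ℤ, k ≤ l → dist (w ^ k • x) (w ^ l • x) = (l - k) * L := by
    intro k l hkl
    obtain ⟨n, rfl⟩ := Int.le.dest hkl
    rw [zpow_add, mul_smul, (hiso _).dist_eq, zpow_natCast, hdist]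
    push_cast; ring
  set γ : ℝ → X := fun t => w ^ ⌊t / L⌋ • σ (t - ⌊t / L⌋ * L) with hγ
  have hcell : ∀ (k : ℤ) (t : ℝ), k * L ≤ t → t ≤ (k + 1) * L → γ t = w ^ k • σ (t - k * L) := by
    intro k t h1 h2
    rcases h2.lt_or_eq with h2 | h2
    · have : ⌊t / L⌋ = k := by
        rw [Int.floor_eq_iff, le_div_iff₀ hL, div_lt_iff₀ hL]
        exact ⟨h1, h2⟩
      simp only [hγ, this]
    · have : ⌊t / L⌋ = k + 1 := by
        rw [h2, mul_div_cancel_right₀ _ hL.ne']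
        exact_mod_cast Int.floor_intCast (R := ℝ) (k + 1)
      simp only [hγ, this]
      rw [h2]
      push_cast
      rw [sub_self, hσ0, show ((k : ℝ) + 1) * L - k * L = L by ring, hσ1, zpow_add_one, mul_smul]
  have hgrid : ∀ k : ℤ, γ (k * L) = w ^ k • x := fun k => by
    rw [hcell k _ le_rfl (by linarith), sub_self, hσ0]
  have hlipcell : ∀ (k : ℤ) (s t : ℝ), k * L ≤ s → s ≤ t → t ≤ (k + 1) * L →
      dist (γ s) (γ t) ≤ t - s := by
    intro k s t h1 h2 h3
    rw [hcell k s h1 (h2.trans h3), hcell k t (h1.trans h2) h3, (hiso _).dist_eq,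
      hσ _ ⟨by linarith, by linarith⟩ _ ⟨by linarith, by linarith⟩, abs_of_nonpos (by linarith)]
    linarith
  have hfl : ∀ t : ℝ, (⌊t / L⌋ : ℝ) * L ≤ t ∧ t ≤ (⌊t / L⌋ + 1) * L := fun t =>
    ⟨(le_div_iff₀ hL).mp (Int.floor_le _), (div_le_iff₀ hL).mp (Int.lt_floor_add_one _).le⟩
  have hlip : ∀ s t : ℝ, s ≤ t → dist (γ s) (γ t) ≤ t - s := by
    intro s t hst
    obtain ⟨hs1, hs2⟩ := hfl s
    obtain ⟨ht1, ht2⟩ := hfl t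
    rcases (Int.floor_mono ((div_le_div_iff_of_pos_right hL).mpr hst)).lt_or_eq with hlt | heq
    · set k := ⌊s / L⌋
      set l := ⌊t / L⌋
      have h1 := hlipcell k s ((k + 1) * L) hs1 hs2 le_rfl
      have h2 := hlipcell l (l * L) t le_rfl ht1 ht2
      have h3 := hdistz (k + 1) l (by omega)
      rw [← hgrid, ← hgrid] at h3
      push_cast at h3
      have h4 := dist_triangle4 (γ s) (γ ((k + 1) * L)) (γ (l * L)) (γ t)
      linarith
    · rw [← heq] at ht2
      exact hlipcell _ s t hs1 hst ht2
  have hge : ∀ s t : ℝ, s ≤ t → dist (γ s) (γ t) = t - s := by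
    intro s t hst
    refine le_antisymm (hlip s t hst) ?_
    set k := ⌊s / L⌋
    set l := ⌊t / L⌋
    have h1 := hlip (k * L) s (hfl s).1
    have h2 := hlip t (((l + 1 : ℤ) : ℝ) * L) (by push_cast; exact (hfl t).2)
    have hkl : k ≤ l := Int.floor_mono ((div_le_div_iff_of_pos_right hL).mpr hst)
    have h3 := hdistz k (l + 1) (by omega)
    rw [← hgrid, ← hgrid] at h3
    have h4 := dist_triangle4 (γ (k * L)) (γ s) (γ t) (γ (((l + 1 : ℤ) : ℝ) * L))
    linarith
  refine ⟨γ, L, fun s t => ?_, hL, fun t => ?_⟩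
  · rcases le_total s t with h | h
    · rw [hge s t h, abs_of_nonpos (by linarith)]; ring
    · rw [dist_comm, hge t s h, abs_of_nonneg (by linarith)]
  · have : ⌊(t + L) / L⌋ = ⌊t / L⌋ + 1 := by
      rw [add_div, div_self hL.ne', Int.floor_add_one]
    simp only [hγ, this]
    rw [← mul_smul, zpow_add_one, (Commute.zpow_self w _).eq]
    push_cast
    congr 2
    ring

end Axis

section LengthBound

variable [Fintype B] [DecidableEq B] {cs : CoxeterSystem M W} {w : W}

theorem rep_inv_of_reflection {x : B → ℝ} (hx : IsRoot cs x) {r : W}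
    (hr : ∀ y, rep cs r y = y - form M x y • x) (y : B → ℝ) :
    rep cs r⁻¹ y = y - form M x y • x := by
  apply rep_injective cs r
  rw [rep_rep_inv, hr]
  simp only [map_sub, map_smul, hx.form_self, smul_eq_mul]
  module

/-- If the walls of two roots cut the chambers into four nonempty quadrants, then the walls
are transverse. -/
theorem abs_form_lt_of_notMem_invSet {t β : B → ℝ} {g f r s : W} (ht : t ∈ invSet cs g)
    (hβ : IsRoot cs β) (hr : ∀ y, rep cs r y = y - form M β y • β)
    (hs : ∀ y, rep cs s y = y - form M (rep cs (g * f)⁻¹ β) y • rep cs (g * f)⁻¹ β)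
    (hpos : 0 ≤ rep cs (g * f)⁻¹ β) (h1 : t ∉ invSet cs r)
    (h2 : -rep cs g⁻¹ t ∉ invSet cs f) (h3 : -rep cs (g * f)⁻¹ t ∉ invSet cs s) :
    |form M t β| < 2 := by
  obtain ⟨htr, ht0, htg⟩ := ht
  set ψ := rep cs (g * f)⁻¹ β with hψ
  have hψr : IsRoot cs ψ := hβ.rep _
  have t1 : 0 ≤ rep cs (1 : W) t := by rwa [rep_one_apply]
  have t2 : 0 ≤ rep cs r⁻¹ t := by
    rw [← (htr.rep _).not_nonpos_iff]
    exact fun h => h1 ⟨htr, ht0, h⟩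
  have t3 : rep cs (g * f)⁻¹ t ≤ 0 := by
    rw [← (htr.rep _).not_nonneg_iff]
    intro h
    refine h2 ⟨(htr.rep _).neg, neg_nonneg.mpr htg, ?_⟩
    rw [map_neg, ← rep_mul_apply, ← mul_inv_rev]
    exact neg_nonpos.mpr h
  have t4 : rep cs (s⁻¹ * (g * f)⁻¹) t ≤ 0 := by
    rw [← (htr.rep _).not_nonneg_iff]
    intro h
    refine h3 ⟨(htr.rep _).neg, neg_nonneg.mpr t3, ?_⟩
    rw [map_neg, ← rep_mul_apply]
    exact neg_nonpos.mpr h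
  have b2 : rep cs r⁻¹ β = -β := by
    rw [rep_inv_of_reflection hβ hr, hβ.form_self]; module
  have b4 : rep cs (s⁻¹ * (g * f)⁻¹) β = -ψ := by
    rw [rep_mul_apply, ← hψ, rep_inv_of_reflection hψr hs, hψr.form_self]; module
  have hq : ∃ u v : W, 0 ≤ rep cs u t ∧ 0 ≤ rep cs v t ∧ 0 ≤ rep cs u β ∧ rep cs v β ≤ 0 := by
    rcases hβ.nonneg_or_nonpos with h | h
    · exact ⟨1, r⁻¹, t1, t2, by rwa [rep_one_apply], by rw [b2]; exact neg_nonpos.mpr h⟩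
    · exact ⟨r⁻¹, 1, t2, t1, by rw [b2]; exact neg_nonneg.mpr h, by rwa [rep_one_apply]⟩
  obtain ⟨u, v, hu, hv, hu', hv'⟩ := hq
  rw [abs_lt]
  constructor
  · by_contra h
    exact not_nonpos_of_form_le htr hβ (not_lt.mp h) hu hu' t4
      (by rw [b4]; exact neg_nonpos.mpr hpos)
  · by_contra h
    refine not_nonpos_of_form_le htr hβ.neg (by rw [map_neg]; linarith) hv ?_ t3 ?_
    · rw [map_neg]; exact neg_nonneg.mpr hv'
    · rw [map_neg]; exact neg_nonpos.mpr hpos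

theorem ncard_biUnion_le {ι α : Type*} (s : Finset ι) (S : ι → Set α) (n : ι → ℕ)
    (h : ∀ i ∈ s, (S i).ncard ≤ n i) : (⋃ i ∈ s, S i).ncard ≤ ∑ i ∈ s, n i := by
  classical
  induction s using Finset.induction_on with
  | empty => simp
  | insert a s ha ih =>
    rw [Finset.set_biUnion_insert, Finset.sum_insert ha]
    exact (Set.ncard_union_le _ _).trans (add_le_add (h a (by simp))
      (ih fun i hi => h i (by simp [hi])))

theorem exists_length_bound {P : B → ℝ} (hP : IsRoot cs P) {K : ℕ}
    (hK : {t | IsRoot cs t ∧ 0 ≤ t ∧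
      ∀ k : ℤ, |k| ≤ K → |form M t (rep cs (w ^ k) P)| < 2}.Finite)
    {F : Set W} (hF : F.Finite) {Ψ : Set (B → ℝ)} (hΨ : Ψ.Finite) :
    ∃ D : ℕ, ∀ (g : W) (f : ℤ → W), (∀ k : ℤ, |k| ≤ K → f k ∈ F ∧
      0 ≤ rep cs (g * f k)⁻¹ (rep cs (w ^ k) P) ∧
      rep cs (g * f k)⁻¹ (rep cs (w ^ k) P) ∈ Ψ) → cs.length g ≤ D := by
  have hrefl : ∀ x, ∃ r : W, IsRoot cs x → ∀ y, rep cs r y = y - form M x y • x := fun x => by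
    by_cases hx : IsRoot cs x
    · obtain ⟨r, hr⟩ := hx.exists_reflection
      exact ⟨r, fun _ => hr⟩
    · exact ⟨1, fun h => absurd h hx⟩
  choose r hr using hrefl
  obtain ⟨a, ha⟩ := (hF.image fun f => (invSet cs f).ncard).bddAbove
  obtain ⟨b, hb⟩ := (hΨ.image fun x => (invSet cs (r x)).ncard).bddAbove
  set T := {t | IsRoot cs t ∧ 0 ≤ t ∧ ∀ k : ℤ, |k| ≤ K → |form M t (rep cs (w ^ k) P)| < 2}
  set I := Finset.Icc (-(K : ℤ)) K
  refine ⟨T.ncard + ∑ k ∈ I, ((invSet cs (r (rep cs (w ^ k) P))).ncard + a + b),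
    fun g f hf => (length_le_ncard_invSet cs g).trans ?_⟩
  set S : ℤ → Set (B → ℝ) := fun k => invSet cs (r (rep cs (w ^ k) P)) ∪
    (fun x => -rep cs g x) '' invSet cs (f k) ∪
    (fun x => -rep cs (g * f k) x) '' invSet cs (r (rep cs (g * f k)⁻¹ (rep cs (w ^ k) P))) with hS
  have hSfin : ∀ k, (S k).Finite := fun k =>
    ((finite_invSet cs _).union ((finite_invSet cs _).image _)).union
      ((finite_invSet cs _).image _)
  have hsub : invSet cs g ⊆ T ∪ ⋃ k ∈ I, S k := by
    intro t ht
    by_contra hcon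
    rw [Set.mem_union, not_or] at hcon
    refine hcon.1 ⟨ht.1, ht.2.1, fun k hk => ?_⟩
    have hkI : k ∈ I := by rw [Finset.mem_Icc]; exact abs_le.mp hk
    have hnot : t ∉ S k := fun h => hcon.2 (Set.mem_biUnion hkI h)
    simp only [hS, Set.mem_union, not_or] at hnot
    have hβ := hP.rep (w ^ k)
    refine abs_form_lt_of_notMem_invSet ht hβ (hr _ hβ) (hr _ (hβ.rep _)) (hf k hk).2.1
      hnot.1.1 (fun h => hnot.1.2 ⟨_, h, ?_⟩) (fun h => hnot.2 ⟨_, h, ?_⟩)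
    · simp only [map_neg, neg_neg, rep_rep_inv]
    · simp only [map_neg, neg_neg, rep_rep_inv]
  have hfin : (T ∪ ⋃ k ∈ I, S k).Finite :=
    hK.union (I.finite_toSet.biUnion fun k _ => hSfin k)
  refine (Set.ncard_le_ncard hsub hfin).trans ((Set.ncard_union_le _ _).trans
    (Nat.add_le_add_left (ncard_biUnion_le _ _ _ fun k hk => ?_) _))
  have hk' : |k| ≤ K := abs_le.mpr (Finset.mem_Icc.mp hk)
  refine (Set.ncard_union_le _ _).trans (add_le_add ((Set.ncard_union_le _ _).trans
    (add_le_add le_rfl ?_)) ?_)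
  · exact (Set.ncard_image_le (finite_invSet cs _)).trans (ha ⟨_, (hf k hk').1, rfl⟩)
  · exact (Set.ncard_image_le (finite_invSet cs _)).trans (hb ⟨_, (hf k hk').2.2, rfl⟩)

end LengthBound

section HalfPlane

/-- A sequence of integers within bounded distance of a linear one, which is monotone at large
scale, has arbitrarily long stretches along which it varies by a controlled amount. -/
theorem exists_slow_window {J : ℤ → ℤ} {N K : ℕ} {L C : ℝ}
    (hmono : ∀ (k : ℤ) (q : ℕ), N ≤ q → J k ≤ J (k + q))
    (hup : ∀ k, (J k : ℝ) ≤ k * L + C) (hlow : ∀ k, k * L - C ≤ J k) :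
    ∃ c : ℤ, ∀ k : ℤ, |k| ≤ K →
      |(J (c + k) : ℝ) - J c| ≤ ((2 * N + 2 * K : ℕ) : ℝ) * L + 1 := by
  by_contra! hcon
  set V : ℕ := 2 * N + 2 * K with hV
  have hstep : ∀ t : ℕ, (J ((t * V : ℕ) : ℤ) : ℝ) + (V * L + 1) ≤ J (((t + 1) * V : ℕ) : ℤ) := by
    intro t
    obtain ⟨k, hk, hA⟩ := hcon ((t * V : ℕ) + N + K)
    rw [abs_le] at hk
    have hmem : ∀ k : ℤ, -(K : ℤ) ≤ k → k ≤ K →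
        J ((t * V : ℕ) : ℤ) ≤ J ((t * V : ℕ) + N + K + k) ∧
        J ((t * V : ℕ) + N + K + k) ≤ J (((t + 1) * V : ℕ) : ℤ) := by
      intro k h1 h2
      constructor
      · have := hmono ((t * V : ℕ) : ℤ) (N + K + k).toNat (by omega)
        rwa [Int.toNat_of_nonneg (by omega), ← add_assoc, ← add_assoc] at this
      · have := hmono ((t * V : ℕ) + N + K + k) (N + K - k).toNat (by omega)
        rw [Int.toNat_of_nonneg (by omega)] at this
        convert this using 2
        rw [add_mul, one_mul]
        push_cast [hV]
        ring
    obtain ⟨h1, h2⟩ := hmem k hk.1 hk.2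
    obtain ⟨h3, h4⟩ := hmem 0 (by omega) (by omega)
    rw [add_zero] at h3 h4
    have h1' : (J ((t * V : ℕ) : ℤ) : ℝ) ≤ J ((t * V : ℕ) + N + K + k) := by exact_mod_cast h1
    have h2' : (J ((t * V : ℕ) + N + K + k) : ℝ) ≤ J (((t + 1) * V : ℕ) : ℤ) := by
      exact_mod_cast h2
    have h3' : (J ((t * V : ℕ) : ℤ) : ℝ) ≤ J ((t * V : ℕ) + N + K) := by exact_mod_cast h3
    have h4' : (J ((t * V : ℕ) + N + K) : ℝ) ≤ J (((t + 1) * V : ℕ) : ℤ) := by exact_mod_cast h4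
    rcases lt_abs.mp hA with h | h <;> linarith
  have htot : ∀ t : ℕ, (J 0 : ℝ) + t * (V * L + 1) ≤ J ((t * V : ℕ) : ℤ) := by
    intro t
    induction t with
    | zero => simp
    | succ t ih =>
      have := hstep t
      push_cast at this ih ⊢
      linarith
  obtain ⟨T, hT⟩ := exists_nat_gt (2 * C)
  have h1 := htot T
  have h2 := hup ((T * V : ℕ) : ℤ)
  have h3 := hlow 0
  push_cast at h1 h2 h3
  nlinarith

variable {X : Type*} [MetricSpace X] [MulAction W X]

theorem finite_dist_smul_le [ProperSpace X] [ProperlyDiscontinuousSMul W X] (x : X) (R : ℝ) :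
    {g : W | dist (g • x) x ≤ R}.Finite :=
  (ProperlyDiscontinuousSMul.finite_disjoint_inter_image (Γ := W)
    (isCompact_singleton (x := x)) (isCompact_closedBall x R)).subset fun g hg =>
      ⟨g • x, ⟨x, rfl, rfl⟩, hg⟩

theorem exists_dist_smul_le (hiso : ∀ w : W, Isometry (fun p : X => w • p))
    (hcocompact : ∃ K : Set X, IsCompact K ∧ ⋃ w : W, (fun p : X => w • p) '' K = Set.univ)
    (x : X) : ∃ R : ℝ, ∀ p : X, ∃ g : W, dist (g • x) p ≤ R := by
  obtain ⟨K, hK, hcov⟩ := hcocompact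
  obtain ⟨R, hR⟩ := hK.isBounded.subset_closedBall x
  refine ⟨R, fun p => ?_⟩
  have : p ∈ ⋃ w : W, (fun p : X => w • p) '' K := by rw [hcov]; trivial
  obtain ⟨g, k, hk, rfl⟩ := Set.mem_iUnion.mp this
  refine ⟨g, ?_⟩
  have := hR hk
  rw [Metric.mem_closedBall, dist_comm] at this
  exact ((hiso g).dist_eq x k).trans_le this

theorem zpow_smul_axis {w : W} {γ : ℝ → X} {L : ℝ} (h : IsAxisOf w γ L) (m : ℤ) (t : ℝ) :
    w ^ m • γ t = γ (t + m * L) := by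
  have hnat : ∀ (n : ℕ) (t : ℝ), w ^ n • γ t = γ (t + n * L) := fun n => by
    induction n with
    | zero => simp
    | succ n ih =>
      intro t
      rw [pow_succ, mul_smul, h.2.2, ih]
      push_cast
      congr 1
      ring
  obtain ⟨n, rfl | rfl⟩ := m.eq_nat_or_neg
  · rw [zpow_natCast, hnat, Int.cast_natCast]
  · rw [zpow_neg, inv_smul_eq_iff, zpow_natCast, hnat]
    push_cast
    congr 1
    ring

variable [Fintype B] [DecidableEq B] {cs : CoxeterSystem M W} {w : W}

/-- A sequence of chambers staying at bounded distance from the orbit of `w` crosses the translates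
of the wall of an oriented root at controlled times. -/
theorem exists_last_crossing {P : B → ℝ} (hP : IsRoot cs P)
    (hpos : ∀ g : W, ∃ m : ℤ, ∀ n ≥ m, 0 ≤ rep cs g (rep cs (w ^ n) P))
    (hneg : ∀ g : W, ∃ m : ℤ, ∀ n ≤ m, rep cs g (rep cs (w ^ n) P) ≤ 0)
    {N : ℕ} (hnest : ∀ q : ℕ, N ≤ q → ∀ g : W,
      rep cs g (rep cs (w ^ (q : ℤ)) P) ≤ 0 → rep cs g P ≤ 0)
    {L : ℝ} (hL : 0 < L) {G : ℤ → W} {F : Set W} (hF : F.Finite)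
    (hG : ∀ i : ℤ, w ^ (-⌊(i : ℝ) / L⌋) * G i ∈ F) :
    ∃ (J : ℤ → ℤ) (C : ℝ),
      (∀ k, ¬ rep cs (G (J k))⁻¹ (rep cs (w ^ k) P) ≤ 0) ∧
      (∀ k, rep cs (G (J k + 1))⁻¹ (rep cs (w ^ k) P) ≤ 0) ∧
      (∀ (k : ℤ) (q : ℕ), N ≤ q → J k ≤ J (k + q)) ∧
      (∀ k, (J k : ℝ) ≤ k * L + C) ∧ ∀ k, k * L - C ≤ J k := by
  choose mp hmp using hpos
  choose mn hmn using hneg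
  obtain ⟨a, ha⟩ := (hF.image fun u => mp u⁻¹).bddAbove
  obtain ⟨b, hb⟩ := (hF.image fun u => mn u⁻¹).bddBelow
  have hrep : ∀ i k : ℤ, rep cs (G i)⁻¹ (rep cs (w ^ k) P) =
      rep cs (w ^ (-⌊(i : ℝ) / L⌋) * G i)⁻¹ (rep cs (w ^ (k - ⌊(i : ℝ) / L⌋)) P) := by
    intro i k
    rw [← rep_mul_apply, ← rep_mul_apply, mul_inv_rev, mul_assoc, zpow_neg, inv_inv, ← zpow_add,
      add_sub_cancel]
  have hout : ∀ i k : ℤ, a ≤ k - ⌊(i : ℝ) / L⌋ → ¬ rep cs (G i)⁻¹ (rep cs (w ^ k) P) ≤ 0 := by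
    intro i k h
    rw [((hP.rep _).rep _).not_nonpos_iff, hrep]
    exact hmp _ _ ((ha ⟨_, hG i, rfl⟩).trans h)
  have hin : ∀ i k : ℤ, k - ⌊(i : ℝ) / L⌋ ≤ b → rep cs (G i)⁻¹ (rep cs (w ^ k) P) ≤ 0 := by
    intro i k h
    rw [hrep]
    exact hmn _ _ (h.trans (hb ⟨_, hG i, rfl⟩))
  have hbd : ∀ k i : ℤ, ¬ rep cs (G i)⁻¹ (rep cs (w ^ k) P) ≤ 0 → (i : ℝ) ≤ (k - b) * L := by
    intro k i h
    by_contra hc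
    refine h (hin i k ?_)
    have : k - b ≤ ⌊(i : ℝ) / L⌋ := by
      rw [Int.le_floor, le_div_iff₀ hL]
      push_cast
      linarith
    linarith
  have hlo : ∀ k : ℤ, ¬ rep cs (G ⌊((k : ℝ) - a) * L⌋)⁻¹ (rep cs (w ^ k) P) ≤ 0 := by
    intro k
    apply hout
    have : ⌊((⌊((k : ℝ) - a) * L⌋ : ℤ) : ℝ) / L⌋ ≤ k - a := by
      rw [Int.floor_le_iff, div_lt_iff₀ hL]
      push_cast
      have := Int.floor_le (((k : ℝ) - a) * L)
      linarith
    linarith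
  have hJ : ∀ k : ℤ, ∃ j : ℤ, ¬ rep cs (G j)⁻¹ (rep cs (w ^ k) P) ≤ 0 ∧
      ∀ i : ℤ, ¬ rep cs (G i)⁻¹ (rep cs (w ^ k) P) ≤ 0 → i ≤ j := fun k =>
    Int.exists_greatest_of_bdd ⟨⌈((k : ℝ) - b) * L⌉, fun i hi => by
      exact_mod_cast (hbd k i hi).trans (Int.le_ceil _)⟩ ⟨_, hlo k⟩
  choose J hJ1 hJ2 using hJ
  refine ⟨J, |a * L| + |b * L| + 1, hJ1, fun k => ?_, fun k q hq => ?_, fun k => ?_, fun k => ?_⟩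
  · by_contra h
    have := hJ2 k _ h
    omega
  · refine hJ2 _ _ fun h => hJ1 k ?_
    rw [← rep_mul_apply] at h ⊢
    refine hnest q hq _ ?_
    rwa [← rep_mul_apply, mul_assoc, ← zpow_add]
  · have := hbd k _ (hJ1 k)
    have := neg_abs_le (b * L)
    have := abs_nonneg (a * L)
    linarith
  · have h1 : (⌊((k : ℝ) - a) * L⌋ : ℝ) ≤ J k := by exact_mod_cast hJ2 k _ (hlo k)
    have := Int.lt_floor_add_one (((k : ℝ) - a) * L)
    have := le_abs_self (a * L)
    have := abs_nonneg (b * L)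
    linarith

theorem not_boundsFlatHalfPlane [ProperSpace X] [ProperlyDiscontinuousSMul W X]
    (hiso : ∀ w : W, Isometry (fun p : X => w • p))
    (hcocompact : ∃ K : Set X, IsCompact K ∧ ⋃ w : W, (fun p : X => w • p) '' K = Set.univ)
    {P : B → ℝ} (hP : IsRoot cs P)
    (hpos : ∀ g : W, ∃ m : ℤ, ∀ n ≥ m, 0 ≤ rep cs g (rep cs (w ^ n) P))
    (hneg : ∀ g : W, ∃ m : ℤ, ∀ n ≤ m, rep cs g (rep cs (w ^ n) P) ≤ 0)
    {N : ℕ} (hnest : ∀ q : ℕ, N ≤ q → ∀ g : W,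
      rep cs g (rep cs (w ^ (q : ℤ)) P) ≤ 0 → rep cs g P ≤ 0)
    {K : ℕ} (hK : {t | IsRoot cs t ∧ 0 ≤ t ∧
      ∀ k : ℤ, |k| ≤ K → |form M t (rep cs (w ^ k) P)| < 2}.Finite)
    {γ : ℝ → X} {L : ℝ} (hγ : IsAxisOf w γ L) : ¬ BoundsFlatHalfPlane γ := by
  rintro ⟨φ, hφ, hφγ⟩
  have hL := hγ.2.1
  set x := γ 0 with hx
  have hwx : ∀ m : ℤ, w ^ m • x = φ (m * L, 0) := fun m => by
    rw [hx, zpow_smul_axis hγ, hφγ, zero_add]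
  obtain ⟨R, hR⟩ := exists_dist_smul_le hiso hcocompact x
  have hdist : ∀ g h : W, dist ((g⁻¹ * h) • x) x = dist (g • x) (h • x) := fun g h => by
    rw [← (hiso g).dist_eq ((g⁻¹ * h) • x) x]
    simp only [mul_smul, smul_inv_smul]
    exact dist_comm _ _
  set A : ℝ := ((2 * N + 2 * K : ℕ) : ℝ) * L + 1 with hA
  obtain ⟨D, hD⟩ := exists_length_bound hP hK
    (finite_dist_smul_le (W := W) x (2 * R + A))
    ((finite_dist_smul_le (W := W) x (2 * R + 1)).biUnion fun u _ => finite_invSet cs u)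
  obtain ⟨R', hR'⟩ := ((finite_length_le cs D).image fun g => dist (g • x) x).bddAbove
  set h : ℝ := |R'| + |R| + 1 with hh
  have hh0 : 0 ≤ h := by positivity
  have hφh : ∀ s t : ℝ, dist (φ (s, h)) (φ (t, h)) = |s - t| := fun s t => by
    rw [hφ _ _ hh0 hh0]
    simp [Real.sqrt_sq_eq_abs]
  have hφ0 : ∀ s t : ℝ, h ≤ dist (φ (s, h)) (φ (t, 0)) := fun s t => by
    rw [hφ _ _ hh0 le_rfl]
    refine Real.le_sqrt_of_sq_le ?_
    simp only [sub_zero]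
    nlinarith [sq_nonneg (s - t)]
  choose G hG using fun i : ℤ => hR (φ (i, h))
  have hGG : ∀ i j : ℤ, dist (G i • x) (G j • x) ≤ 2 * R + |(i : ℝ) - j| := fun i j => by
    have h1 := dist_triangle4 (G i • x) (φ (i, h)) (φ (j, h)) (G j • x)
    have h2 := hG i
    have h3 := hG j
    rw [dist_comm] at h3
    rw [hφh] at h1
    linarith
  have hGw : ∀ i : ℤ, w ^ (-⌊(i : ℝ) / L⌋) * G i ∈ {g : W | dist (g • x) x ≤ R + (L + h)} := by
    intro i
    set m := ⌊(i : ℝ) / L⌋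
    have h1 : (m : ℝ) * L ≤ i := (le_div_iff₀ hL).mp (Int.floor_le _)
    have h2 : (i : ℝ) ≤ (m + 1) * L := (div_le_iff₀ hL).mp (Int.lt_floor_add_one _).le
    rw [Set.mem_ofPred_eq, zpow_neg, hdist, dist_comm, hwx]
    refine (dist_triangle _ _ _).trans (add_le_add (hG i) ?_)
    rw [hφ _ _ hh0 le_rfl]
    refine Real.sqrt_le_iff.mpr ⟨by linarith, ?_⟩
    have h3 : 0 ≤ (i : ℝ) - m * L := by linarith
    have h4 : (i : ℝ) - m * L ≤ L := by linarith
    simp only [sub_zero]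
    nlinarith
  obtain ⟨J, C, hJ1, hJ2, hmono, hup, hlow⟩ :=
    exists_last_crossing hP hpos hneg hnest hL (finite_dist_smul_le x _) hGw
  obtain ⟨c, hc⟩ := exists_slow_window (K := K) hmono hup hlow
  have hlen := hD (w ^ (-c) * G (J c)) (fun k => (G (J c))⁻¹ * G (J (c + k))) fun k hk => ?_
  · have h1 := hR' ⟨_, hlen, rfl⟩
    simp only at h1
    rw [zpow_neg, hdist, hwx] at h1
    have h2 := hφ0 (J c) (c * L)
    have h3 := dist_triangle (φ (J c, h)) (G (J c) • x) (φ (c * L, 0))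
    have h4 := hG (J c)
    rw [dist_comm] at h4 h1
    have := le_abs_self R
    have := le_abs_self R'
    linarith
  · have heq : rep cs (w ^ (-c) * G (J c) * ((G (J c))⁻¹ * G (J (c + k))))⁻¹ (rep cs (w ^ k) P) =
        rep cs (G (J (c + k)))⁻¹ (rep cs (w ^ (c + k)) P) := by
      rw [← rep_mul_apply, ← rep_mul_apply, zpow_add, zpow_neg]
      congr 2
      group
    have hnn : 0 ≤ rep cs (G (J (c + k)))⁻¹ (rep cs (w ^ (c + k)) P) := by
      rw [← ((hP.rep _).rep _).not_nonpos_iff]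
      exact hJ1 _
    refine ⟨?_, by rwa [heq], ?_⟩
    · rw [Set.mem_ofPred_eq, hdist]
      refine (hGG _ _).trans ?_
      have := hc k hk
      rw [abs_sub_comm] at this
      linarith
    · rw [heq]
      refine Set.mem_biUnion (x := (G (J (c + k)))⁻¹ * G (J (c + k) + 1)) ?_
        ⟨(hP.rep _).rep _, hnn, ?_⟩
      · rw [Set.mem_ofPred_eq, hdist]
        refine (hGG _ _).trans ?_
        push_cast
        rw [sub_add_cancel_left, abs_neg, abs_one]
      · rw [← rep_mul_apply, mul_inv_rev, inv_inv, mul_assoc, mul_inv_cancel, mul_one]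
        exact hJ2 _

end HalfPlane

end CoxRank

theorem coxeterElement_rank_one
    [Finite B] (cs : CoxeterSystem M W)
    (hirr : cs.IsIrreducibleSystem) (hinf : Infinite W)
    (hnonaffine : ¬ ∃ A : Subgroup W, (∀ x ∈ A, ∀ y ∈ A, Commute x y) ∧
      A.FiniteIndex)
    -- the Davis complex: a proper geodesic CAT(0) space with a geometric action
    (X : Type*) [MetricSpace X] [ProperSpace X] [Nonempty X]
    (hgeo : IsGeodesicSpace X) (hCN : SatisfiesCN X)
    [MulAction W X] (hiso : ∀ w : W, Isometry (fun p : X => w • p))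
    [ProperlyDiscontinuousSMul W X]
    (hcocompact : ∃ K : Set X, IsCompact K ∧ ⋃ w : W, (fun p : X => w • p) '' K = Set.univ)
    -- a Coxeter element: a product of all the generators, each appearing once
    (l : List B) (hnodup : l.Nodup) (hall : ∀ b : B, b ∈ l)
    (w : W) (hw : w = cs.wordProd l) :
    (∃ (γ : ℝ → X) (L : ℝ), IsAxisOf w γ L) ∧
    ∀ (γ : ℝ → X) (L : ℝ), IsAxisOf w γ L → ¬ BoundsFlatHalfPlane γ := by
  cases nonempty_fintype B
  classical
  subst hw
  obtain ⟨E⟩ := CoxRank.exists_eulerData cs l hnodup hall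
  obtain ⟨O⟩ := E.exists_orientedRoots hirr hnonaffine
  obtain ⟨v, hv, -⟩ := CoxRank.exists_limit_vector cs
  obtain ⟨i, -⟩ := Function.ne_iff.mp hv
  obtain ⟨N, hN⟩ := O.nested_of_large E hirr hnonaffine i
  obtain ⟨K, hK⟩ := O.finite_transverse E hirr hnonaffine i
  refine ⟨CoxRank.exists_axis hgeo hCN hiso hcocompact fun a b h => ?_, fun γ L hγ =>
    CoxRank.not_boundsFlatHalfPlane hiso hcocompact (O.root i) (O.pos i) (O.neg i) hN hK hγ⟩
  refine O.zpow_injective i ?_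
  simp only at h ⊢
  rw [h]
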